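/- Let Q1, Q2 ⊂ ℝ^2 be lattice polygons, let k ≥ 2 be an integer, and let P = conv(Q1×{0} ∪ Q2×{k}) ⊂ ℝ^3. If the slice P ∩ (ℝ^2 × {1}) is a lattice polygon (i.e., it is the convex hull of its points in ℤ^3), then P has a unimodular cover. -/

import Mathlib

open scoped Pointwise

noncomputable section

/-- The real point corresponding to an integer point of `ℤ³`. -/
def toR3 (v : Fin 3 → ℤ) : Fin 3 → ℝ := fun i => (v i : ℝ)

/-- The real point corresponding to an integer point of `ℤ²`. -/
def toR2 (v : Fin 2 → ℤ) : Fin 2 → ℝ := fun i => (v i : ℝ)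

/-- The set of lattice points of `ℝ³`. -/
def Lat3 : Set (Fin 3 → ℝ) := Set.range toR3

/-- A unimodular tetrahedron: the convex hull of lattice points `v0, v1, v2, v3`
such that `v1 - v0, v2 - v0, v3 - v0` form a `ℤ`-basis of `ℤ³`. -/
def IsUnimodularTet (S : Set (Fin 3 → ℝ)) : Prop :=
  ∃ v : Fin 4 → Fin 3 → ℤ,
    S = convexHull ℝ {toR3 (v 0), toR3 (v 1), toR3 (v 2), toR3 (v 3)} ∧
    (Matrix.of ![v 1 - v 0, v 2 - v 0, v 3 - v 0]).det ∈ ({1, -1} : Set ℤ)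

/-- A unimodular cover of `P`. -/
def HasUnimodularCover (P : Set (Fin 3 → ℝ)) : Prop :=
  ∃ 𝒞 : Set (Set (Fin 3 → ℝ)),
    (∀ S ∈ 𝒞, IsUnimodularTet S ∧ S ⊆ P) ∧ ⋃₀ 𝒞 = P

/-- A lattice polytope in `ℝ²`: the convex hull of a nonempty finite set of
lattice points. -/
def IsLatticePolytope2 (P : Set (Fin 2 → ℝ)) : Prop :=
  ∃ V : Finset (Fin 2 → ℤ), V.Nonempty ∧ P = convexHull ℝ (toR2 '' ↑V)



lemma arith_core (d c j X N α y : ℤ) (l0 l r0 r : ℝ)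
    (hd : 2 ≤ d) (hc : 0 < c) (hcd : c < d) (hj : 0 < j) (hjd : j < d)
    (hjc : d ∣ j * c - 1) (hdiv : d ∣ N + c * X) (hX : d ≤ X) (hN : 0 ≤ N)
    (hNX : N * (d - j) < X) (hy : y ≤ 0 ∨ d ≤ y)
    (htop : X * (d - y) ≤ N * α)
    (hR : (α : ℝ) ≤ r0 + r * y) (hL : l0 + l * (y + N) ≤ (α : ℝ) - X)
    (hr0 : 0 ≤ r0) (hrd : 0 ≤ r0 + r * d)
    (hrc : r0 + r * c < 1) (hlc : -1 < l0 + l * (d - c)) (hrl : r ≤ l) : False := by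
  have hNltX : N < X := by nlinarith
  have hdR : (2:ℝ) ≤ d := by exact_mod_cast hd
  have hcR : (1:ℝ) ≤ c := by exact_mod_cast hc
  have hcdR : (c:ℝ) + 1 ≤ d := by exact_mod_cast hcd
  have hXR : (d:ℝ) ≤ X := by exact_mod_cast hX
  have hNR : (0:ℝ) ≤ N := by exact_mod_cast hN
  have hNXR : (N:ℝ) < X := by exact_mod_cast hNltX
  have hr1 : -1 < r * (d - c) := by nlinarith
  have hr1' : -1 < r := by
    by_contra h; push Not at h; nlinarith
  rcases hy with hy | hy
  · have hyR : (y:ℝ) ≤ 0 := by exact_mod_cast hy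
    have h1 : (α:ℝ) < d - y := by
      have : -r * (c - y) ≤ c - y := by nlinarith
      nlinarith
    have h2 : α < d - y := by exact_mod_cast h1
    have h3 : 0 < d - y := by omega
    by_cases h4 : α ≤ 0
    · nlinarith
    · nlinarith
  · have hyR : (d:ℝ) ≤ y := by exact_mod_cast hy
    have hw : (X:ℝ) + l * N ≤ (r0 + r * d) - (l0 + l * d) := by nlinarith
    have hw2 : (X:ℝ) + l * N < 2 + r * (d - c) - l * c := by nlinarith
    by_cases hl : 0 ≤ l
    · have : (0:ℝ) ≤ l * N := by positivity
      by_cases hr : r ≤ 0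
      · nlinarith
      · push Not at hr
        have h5 : r * c < 1 := by linarith
        have h6 : r * c ≤ l * c := by nlinarith
        by_cases h7 : (d:ℝ) ≤ 2 * c
        · nlinarith
        · push Not at h7
          have h8 : r * (d - 2 * c) ≤ d - 2 * c := by
            have : r ≤ 1 := by nlinarith
            nlinarith
          nlinarith
    · push Not at hl
      have h5 : -l * (d - c) < 1 := by nlinarith
      have h6 : (X:ℝ) + l * N < 2 - l * (2 * c - d) := by nlinarith
      by_cases h7 : c = d - 1
      · have h8 : d ∣ X - N := by
          have : X - N = d * X - (N + c * X) := by rw [h7]; ring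
          rw [this]; exact dvd_sub (dvd_mul_right _ _) hdiv
        have h9 : d ≤ X - N := Int.le_of_dvd (by omega) h8
        have h9R : (d:ℝ) ≤ X - N := by exact_mod_cast h9
        have h10 : (c:ℝ) = d - 1 := by exact_mod_cast h7
        rw [h10] at h5 h6
        have h11 : -l < 1 := by nlinarith
        nlinarith
      · have h8 : c ≤ d - 2 := by omega
        have h8R : (c:ℝ) ≤ d - 2 := by exact_mod_cast h8
        have h9 : j ≠ d - 1 := by
          intro h
          have : d ∣ c + 1 := by
            have e : c + 1 = d * c - (j * c - 1) := by rw [h]; ring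
            rw [e]; exact dvd_sub (dvd_mul_right _ _) hjc
          have := Int.le_of_dvd (by omega) this
          omega
        have h10 : 2 * N ≤ X := by nlinarith [show 2 ≤ d - j by omega]
        have h10R : 2 * (N:ℝ) ≤ X := by exact_mod_cast h10
        have h11 : -l < 1/2 := by nlinarith
        have h12 : -l * N ≤ X / 4 := by nlinarith
        by_cases h13 : 2 * (c:ℝ) ≤ d
        · have h14 : -l * (2 * c - d) ≤ 0 :=
            mul_nonpos_of_nonneg_of_nonpos (by linarith) (by linarith)
          linarith
        · push Not at h13
          have h14 : -l * (2 * c - d) ≤ 1/2 * (2 * c - d) :=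
            mul_le_mul_of_nonneg_right (by linarith) (by linarith)
          linarith

lemma edge_exists (S : Set (ℤ × ℤ)) (hfin : S.Finite) (d : ℤ) (hd : 0 < d)
    (hS : ∀ p ∈ S, p.1 ≤ 0 ∨ d ≤ p.1) (a a' : ℤ × ℤ) (ha : a ∈ S) (ha' : a' ∈ S)
    (ha1 : a.1 ≤ 0) (ha1' : d ≤ a'.1) :
    ∃ x ∈ S, ∃ x' ∈ S, x.1 ≤ 0 ∧ d ≤ x'.1 ∧
      ∀ p ∈ S, (x'.1 - x.1) * (p.2 - x.2) ≤ (x'.2 - x.2) * (p.1 - x.1) := by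
  set T : Set ((ℤ × ℤ) × (ℤ × ℤ)) := {q | (q.1 ∈ S ∧ q.1.1 ≤ 0) ∧ (q.2 ∈ S ∧ d ≤ q.2.1)} with hT
  have hTfin : T.Finite := by
    apply (hfin.prod hfin).subset
    rintro q hq
    exact ⟨hq.1.1, hq.2.1⟩
  have hTne : T.Nonempty := ⟨(a, a'), ⟨ha, ha1⟩, ha', ha1'⟩
  set f : ((ℤ × ℤ) × (ℤ × ℤ)) → ℝ := fun q =>
    ((q.1.2 : ℝ) * (q.2.1 - 1/2) + q.2.2 * (1/2 - q.1.1)) / (q.2.1 - q.1.1) with hf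
  obtain ⟨⟨x, x'⟩, ⟨⟨hx, hx1⟩, hx', hx1'⟩, hmax⟩ := Set.exists_max_image T f hTfin hTne
  simp only at hx hx1 hx' hx1'
  refine ⟨x, hx, x', hx', hx1, hx1', fun p hp => ?_⟩
  have e1 : (x.1:ℝ) ≤ 0 := by exact_mod_cast hx1
  have e2 : (1:ℝ) ≤ x'.1 := by exact_mod_cast (by omega : (1:ℤ) ≤ x'.1)
  have key : ((x'.1:ℝ) - x.1) * (p.2 - x.2) ≤ (x'.2 - x.2) * (p.1 - x.1) := by
    rcases hS p hp with h | h
    · have h1 := hmax (p, x') ⟨⟨hp, h⟩, hx', hx1'⟩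
      have e3 : (p.1:ℝ) ≤ 0 := by exact_mod_cast h
      simp only [hf] at h1
      rw [div_le_div_iff₀ (by linarith) (by linarith)] at h1
      by_contra hcon
      push Not at hcon
      nlinarith [mul_pos (sub_pos.2 hcon) (show (0:ℝ) < x'.1 - 1/2 by linarith)]
    · have h1 := hmax (x, p) ⟨⟨hx, hx1⟩, hp, h⟩
      have e3 : (1:ℝ) ≤ p.1 := by exact_mod_cast (by omega : (1:ℤ) ≤ p.1)
      simp only [hf] at h1
      rw [div_le_div_iff₀ (by linarith) (by linarith)] at h1
      by_contra hcon
      push Not at hcon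
      nlinarith [mul_pos (sub_pos.2 hcon) (show (0:ℝ) < 1/2 - x.1 by linarith)]
  exact_mod_cast key

/-- lattice points, in coordinates -/
def LP (d c : ℤ) (A : Set (ℝ × ℝ)) : Set (ℤ × ℤ) :=
  {p | d ∣ p.2 - c * p.1 ∧ ((p.1 : ℝ), (p.2 : ℝ)) ∈ A}

lemma top_edge (d c j : ℤ) (hd : 2 ≤ d) (hj : 0 < j) (hjd : j < d)
    (hjc : d ∣ j * c - 1) (A : Set (ℝ × ℝ)) (hA : Convex ℝ A) (hfin : (LP d c A).Finite)
    (h0 : ((0:ℝ), (0:ℝ)) ∈ A) (h1 : ((d:ℝ), (0:ℝ)) ∈ A)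
    (hS : ∀ p ∈ LP d c A, p.1 ≤ 0 ∨ d ≤ p.1) :
    ∃ x ∈ LP d c A, ∃ x' ∈ LP d c A, ∃ f0 f : ℝ, x.1 ≤ 0 ∧ d ≤ x'.1 ∧
      (∀ p ∈ LP d c A, (x'.1 - x.1) * (p.2 - x.2) ≤ (x'.2 - x.2) * (p.1 - x.1)) ∧
      f * (x'.1 - x.1) = x'.2 - x.2 ∧ 0 ≤ f0 ∧ 0 ≤ f0 + f * d ∧ f0 + f * j < 1 ∧
      ∀ p ∈ LP d c A, (p.2 : ℝ) ≤ f0 + f * p.1 := by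
  have m0 : ((0:ℤ), (0:ℤ)) ∈ LP d c A := ⟨by simp, by simpa using h0⟩
  have m1 : (d, (0:ℤ)) ∈ LP d c A := ⟨by simp, by simpa using h1⟩
  obtain ⟨x, hx, x', hx', hx1, hx1', htop⟩ :=
    edge_exists _ hfin d (by omega) hS _ _ m0 m1 le_rfl le_rfl
  have e1 : (x.1:ℝ) ≤ 0 := by exact_mod_cast hx1
  have e2 : (d:ℝ) ≤ x'.1 := by exact_mod_cast hx1'
  have e3 : (2:ℝ) ≤ d := by exact_mod_cast hd
  have e4 : (0:ℝ) < j := by exact_mod_cast hj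
  have e5 : (j:ℝ) < d := by exact_mod_cast hjd
  have hX : (0:ℝ) < x'.1 - x.1 := by linarith
  set f : ℝ := (x'.2 - x.2) / (x'.1 - x.1) with hf
  have hfX : f * (x'.1 - x.1) = x'.2 - x.2 := by rw [hf]; field_simp
  set f0 : ℝ := x.2 - f * x.1 with hf0
  have hbound : ∀ p ∈ LP d c A, (p.2 : ℝ) ≤ f0 + f * p.1 := by
    intro p hp
    have := htop p hp
    have : ((x'.1:ℝ) - x.1) * (p.2 - x.2) ≤ (x'.2 - x.2) * (p.1 - x.1) := by exact_mod_cast this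
    rw [← hfX] at this
    have : ((x'.1:ℝ) - x.1) * (p.2 - x.2) ≤ (x'.1 - x.1) * (f * (p.1 - x.1)) := by linarith
    have := le_of_mul_le_mul_left this hX
    rw [hf0]; linarith
  refine ⟨x, hx, x', hx', f0, f, hx1, hx1', htop, hfX, ?_, ?_, ?_, hbound⟩
  · simpa using hbound _ m0
  · simpa using hbound _ m1
  · by_contra hcon
    push Not at hcon
    -- point on F
    have hFj : ((j:ℝ), f0 + f * j) ∈ A := by
      have := hA hx.2 hx'.2 (a := (x'.1 - j) / (x'.1 - x.1)) (b := (j - x.1) / (x'.1 - x.1))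
        (div_nonneg (by linarith) hX.le) (div_nonneg (by linarith) hX.le) (by field_simp; ring)
      convert this using 1
      ext
      · simp; field_simp; ring
      · simp only [Prod.snd_add, Prod.smul_snd, smul_eq_mul]
        have : (x'.2:ℝ) = x.2 + f * (x'.1 - x.1) := by linarith
        rw [this, hf0]; field_simp; ring
    have hej : ((j:ℝ), (0:ℝ)) ∈ A := by
      have := hA h0 h1 (a := (d - j) / d) (b := j / d)
        (div_nonneg (by linarith) (by linarith)) (div_nonneg (by linarith) (by linarith))
        (by field_simp; ring)
      convert this using 1
      ext
      · simp; field_simp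
      · simp
    have hm : ((j:ℝ), (1:ℝ)) ∈ A := by
      have hpos : 0 < f0 + f * j := by linarith
      have := hA hej hFj (a := 1 - 1 / (f0 + f * j)) (b := 1 / (f0 + f * j))
        (by rw [sub_nonneg, div_le_one hpos]; exact hcon) (by positivity) (by ring)
      convert this using 1
      ext
      · simp; ring
      · simp; field_simp
    have : (j, (1:ℤ)) ∈ LP d c A := by
      refine ⟨?_, by simpa using hm⟩
      have : (1:ℤ) - c * j = -(j * c - 1) := by ring
      simp only [this]; exact (dvd_neg).2 hjc
    rcases hS _ this with h | h <;> simp at h <;> omega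


def RefC (d c : ℤ) (A B : Set (ℝ × ℝ)) : Prop :=
  ∀ x ∈ LP d c A, ∀ x' ∈ LP d c A, x ≠ x' →
    (∀ p ∈ LP d c A, (x'.1 - x.1) * (p.2 - x.2) ≤ (x'.2 - x.2) * (p.1 - x.1)) →
    ∃ y ∈ LP d c B, ∃ y' ∈ LP d c B, y ≠ y' ∧
      (x'.1 - x.1) * (y'.2 - y.2) = (x'.2 - x.2) * (y'.1 - y.1) ∧
      ∀ q ∈ LP d c B, (x'.1 - x.1) * (q.2 - y.2) ≤ (x'.2 - x.2) * (q.1 - y.1)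

lemma key_top (d c j : ℤ) (hd : 2 ≤ d) (hc : 0 < c) (hcd : c < d) (hj : 0 < j) (hjd : j < d)
    (hjc : d ∣ j * c - 1) (A B : Set (ℝ × ℝ)) (hA : Convex ℝ A)
    (hfinA : (LP d c A).Finite)
    (hA0 : ((0:ℝ), (0:ℝ)) ∈ A) (hA1 : ((d:ℝ), (0:ℝ)) ∈ A)
    (hB1 : ((0:ℝ), (d:ℝ)) ∈ B)
    (hSA : ∀ p ∈ LP d c A, p.1 ≤ 0 ∨ d ≤ p.1)
    (hSB : ∀ p ∈ LP d c B, p.2 ≤ 0 ∨ d ≤ p.2)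
    (href : RefC d c A B) (l0 l r0 r : ℝ)
    (hR : ∀ q ∈ LP d c B, (q.1 : ℝ) ≤ r0 + r * q.2)
    (hL : ∀ q ∈ LP d c B, l0 + l * q.2 ≤ (q.1 : ℝ))
    (hr0 : 0 ≤ r0) (hrd : 0 ≤ r0 + r * d) (hl0 : l0 ≤ 0) (hld : l0 + l * d ≤ 0)
    (hrc : r0 + r * c < 1) (hlc : -1 < l0 + l * (d - c)) (hrl : r ≤ l) : False := by
  obtain ⟨x, hx, x', hx', f0, f, hx1, hx1', htop, hfX, hf0, hfd, hfj, -⟩ :=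
    top_edge d c j hd hj hjd hjc A hA hfinA hA0 hA1 hSA
  have hXpos : 0 < x'.1 - x.1 := by omega
  have hne : x ≠ x' := by rintro rfl; omega
  have hB1' : ((0:ℤ), d) ∈ LP d c B := ⟨by simp, by simpa using hB1⟩
  -- get y, y' ordered
  obtain ⟨y, hy, y', hy', hlt, hpar, hytop⟩ : ∃ y ∈ LP d c B, ∃ y' ∈ LP d c B, y.1 < y'.1 ∧
      (x'.1 - x.1) * (y'.2 - y.2) = (x'.2 - x.2) * (y'.1 - y.1) ∧
      ∀ q ∈ LP d c B, (x'.1 - x.1) * (q.2 - y.2) ≤ (x'.2 - x.2) * (q.1 - y.1) := by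
    obtain ⟨y, hy, y', hy', hyne, hpar, hytop⟩ := href x hx x' hx' hne htop
    rcases lt_trichotomy y.1 y'.1 with h | h | h
    · exact ⟨y, hy, y', hy', h, hpar, hytop⟩
    · exfalso
      rw [h, sub_self, mul_zero] at hpar
      rcases mul_eq_zero.1 hpar with h' | h'
      · omega
      · exact hyne (Prod.ext h (by omega))
    · refine ⟨y', hy', y, hy, h, by linarith, fun q hq => ?_⟩
      have := hytop q hq
      linarith
  set X := y'.1 - y.1 with hXdef
  set Y := y'.2 - y.2 with hYdef
  have hXp : 0 < X := by omega
  have hdvdXY : d ∣ Y - c * X := by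
    have := dvd_sub hy'.1 hy.1
    have e : Y - c * X = (y'.2 - c * y'.1) - (y.2 - c * y.1) := by rw [hXdef, hYdef]; ring
    rw [e]; exact this
  have hfX' : f * X = Y := by
    have h1 : ((x'.1:ℝ) - x.1) * Y = (x'.2 - x.2) * X := by exact_mod_cast hpar
    have h2 : (0:ℝ) < (x'.1:ℝ) - x.1 := by exact_mod_cast hXpos
    rw [← hfX] at h1
    have : ((x'.1:ℝ) - x.1) * Y = (x'.1 - x.1) * (f * X) := by linarith
    exact (mul_left_cancel₀ h2.ne' this).symm
  -- X ≥ d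
  have hXd : d ≤ X := by
    by_contra hcon
    push Not at hcon
    -- n = number of steps
    set n : ℤ := (-x.1) / X + 1 with hn
    have hn1 : 0 < x.1 + n * X := by
      have := Int.lt_ediv_add_one_mul_self (-x.1) hXp
      rw [hn]; linarith
    have hn2 : x.1 + n * X ≤ X := by
      have := Int.ediv_mul_le (-x.1) hXp.ne'
      rw [hn]; linarith
    have hn0 : 0 ≤ n := by
      have : 0 ≤ (-x.1) / X := Int.ediv_nonneg (by omega) hXp.le
      omega
    have hmem : (x.1 + n * X, x.2 + n * Y) ∈ LP d c A := by
      refine ⟨?_, ?_⟩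
      · have e : x.2 + n * Y - c * (x.1 + n * X) = (x.2 - c * x.1) + n * (Y - c * X) := by ring
        simp only [e]
        exact dvd_add hx.1 (Dvd.dvd.mul_left hdvdXY n)
      · have hP : (0:ℝ) < (x'.1:ℝ) - x.1 := by exact_mod_cast hXpos
        have hnX : 0 ≤ (n:ℝ) * X := by
          have : 0 ≤ n * X := by positivity
          exact_mod_cast this
        have hle : (n:ℝ) * X ≤ x'.1 - x.1 := by
          have : n * X ≤ x'.1 - x.1 := by omega
          exact_mod_cast this
        have := hA hx.2 hx'.2 (a := 1 - n * X / (x'.1 - x.1)) (b := n * X / (x'.1 - x.1))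
          (by rw [sub_nonneg, div_le_one hP]; exact hle) (div_nonneg hnX hP.le) (by ring)
        convert this using 1
        ext
        · simp; field_simp; ring
        · have h3 : (x'.2:ℝ) = x.2 + f * (x'.1 - x.1) := by linarith
          simp only [Prod.snd_add, Prod.smul_snd, smul_eq_mul]
          rw [h3]; push_cast; rw [← hfX']; field_simp; ring
    rcases hSA _ hmem with h | h <;> simp only at h <;> omega
  have hXdR : (d:ℝ) ≤ X := by exact_mod_cast hXd
  have hdR : (2:ℝ) ≤ d := by exact_mod_cast hd
  have hXR : (0:ℝ) < X := by exact_mod_cast hXp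
  -- top in terms of X Y
  have hytop' : ∀ q ∈ LP d c B, X * (q.2 - y.2) ≤ Y * (q.1 - y.1) := by
    intro q hq
    have h1 : ((x'.1:ℝ) - x.1) * (q.2 - y.2) ≤ (x'.2 - x.2) * (q.1 - y.1) := by
      exact_mod_cast hytop q hq
    rw [← hfX] at h1
    have hP : (0:ℝ) < (x'.1:ℝ) - x.1 := by exact_mod_cast hXpos
    have h2 : ((x'.1:ℝ) - x.1) * (q.2 - y.2) ≤ (x'.1 - x.1) * (f * (q.1 - y.1)) := by linarith
    have h3 := le_of_mul_le_mul_left h2 hP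
    have h4 : (X:ℝ) * (q.2 - y.2) ≤ Y * (q.1 - y.1) := by
      rw [← hfX']
      calc (X:ℝ) * (q.2 - y.2) ≤ X * (f * (q.1 - y.1)) := mul_le_mul_of_nonneg_left h3 hXR.le
        _ = _ := by ring
    exact_mod_cast h4
  have htopd := hytop' _ hB1'
  simp only at htopd
  rcases le_total Y 0 with hY | hY
  · -- lower point is y'
    have hs : (-Y) * (d - j) < X := by
      have : (-(Y:ℝ)) * (d - j) < X := by
        rw [← hfX']
        have : -f * (d - j) < 1 := by linarith
        nlinarith
      exact_mod_cast this
    refine arith_core d c j X (-Y) y'.1 y'.2 l0 l r0 r hd hc hcd hj hjd hjc ?_ hXd (by omega) hs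
      (hSB _ hy') ?_ (hR _ hy') ?_ hr0 hrd hrc hlc hrl
    · have : -Y + c * X = -(Y - c * X) := by ring
      rw [this]; exact (dvd_neg).2 hdvdXY
    · have e1 : y'.1 = X + y.1 := by rw [hXdef]; ring
      have e2 : y'.2 = Y + y.2 := by rw [hYdef]; ring
      rw [e1, e2]; linarith
    · have := hL _ hy
      have e1 : (X:ℝ) = y'.1 - y.1 := by rw [hXdef]; push_cast; ring
      have e2 : (Y:ℝ) = y'.2 - y.2 := by rw [hYdef]; push_cast; ring
      push_cast; rw [e1, e2]
      have e3 : (y'.2:ℝ) + -(y'.2 - y.2) = y.2 := by ring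
      rw [e3]; linarith
  · -- lower point is y; mirror
    have hs : Y * (d - (d - j)) < X := by
      have : (Y:ℝ) * (d - (d - j)) < X := by
        rw [← hfX']
        have : f * j < 1 := by linarith
        nlinarith
      exact_mod_cast this
    refine arith_core d (d - c) (d - j) X Y (-y.1) y.2 (-r0) (-r) (-l0) (-l) hd (by omega) (by omega)
      (by omega) (by omega) ?_ ?_ hXd hY hs (hSB _ hy) ?_ ?_ ?_ (by linarith) (by linarith)
      ?_ ?_ (by linarith)
    · have : (d - j) * (d - c) - 1 = d * (d - j - c) + (j * c - 1) := by ring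
      rw [this]; exact dvd_add (dvd_mul_right _ _) hjc
    · have : Y + (d - c) * X = d * X + (Y - c * X) := by ring
      rw [this]; exact dvd_add (dvd_mul_right _ _) hdvdXY
    · linarith
    · have := hL _ hy; push_cast; linarith
    · have := hR _ hy'
      have e1 : (X:ℝ) = y'.1 - y.1 := by rw [hXdef]; push_cast; ring
      have e2 : (Y:ℝ) = y'.2 - y.2 := by rw [hYdef]; push_cast; ring
      push_cast; rw [e1, e2]
      have e3 : (y.2:ℝ) + (y'.2 - y.2) = y'.2 := by ring
      rw [e3]; linarith
    · push_cast; linarith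
    · push_cast
      have : (d:ℝ) - (d - c) = c := by ring
      rw [this]; linarith

/-- The right line of `B`. -/
lemma right_line (d c j : ℤ) (hd : 2 ≤ d) (hc : 0 < c) (hcd : c < d)
    (hjc : d ∣ j * c - 1) (B : Set (ℝ × ℝ)) (hB : Convex ℝ B) (hfin : (LP d c B).Finite)
    (h0 : ((0:ℝ), (0:ℝ)) ∈ B) (h1 : ((0:ℝ), (d:ℝ)) ∈ B)
    (hS : ∀ p ∈ LP d c B, p.2 ≤ 0 ∨ d ≤ p.2) :
    ∃ r0 r : ℝ, 0 ≤ r0 ∧ 0 ≤ r0 + r * d ∧ r0 + r * c < 1 ∧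
      ∀ p ∈ LP d c B, (p.1 : ℝ) ≤ r0 + r * p.2 := by
  set B' : Set (ℝ × ℝ) := (fun p : ℝ × ℝ => (p.2, p.1)) ⁻¹' B with hB'
  have hiff : ∀ p : ℤ × ℤ, p ∈ LP d j B' → (p.2, p.1) ∈ LP d c B := by
    rintro p ⟨h1, h2⟩
    refine ⟨?_, h2⟩
    have e : p.1 - c * p.2 = -(p.1 * (j * c - 1)) - c * (p.2 - j * p.1) := by ring
    simp only [e]
    exact dvd_sub ((dvd_neg).2 (Dvd.dvd.mul_left hjc _)) (Dvd.dvd.mul_left h1 _)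
  have hiff' : ∀ p : ℤ × ℤ, p ∈ LP d c B → (p.2, p.1) ∈ LP d j B' := by
    rintro p ⟨h1, h2⟩
    refine ⟨?_, h2⟩
    have e : p.1 - j * p.2 = -(p.1 * (j * c - 1)) - j * (p.2 - c * p.1) := by ring
    simp only [e]
    exact dvd_sub ((dvd_neg).2 (Dvd.dvd.mul_left hjc _)) (Dvd.dvd.mul_left h1 _)
  have hconv : Convex ℝ B' := by
    intro p hp q hq a b ha hb hab
    exact hB hp hq ha hb hab
  obtain ⟨x, hx, x', hx', f0, f, -, -, -, -, g1, g2, g3, g4⟩ :=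
    top_edge d j c hd hc hcd (by rwa [mul_comm]) B' hconv
      ((hfin.preimage (f := fun p : ℤ × ℤ => (p.2, p.1))
        (fun p _ q _ h => by simp at h; exact Prod.ext h.2 h.1)).subset
        (fun p hp => hiff p hp)) h0 h1 (fun p hp => hS _ (hiff p hp))
  exact ⟨f0, f, g1, g2, g3, fun p hp => g4 _ (hiff' p hp)⟩

lemma refl_LP (d c s t : ℤ) (hst : d ∣ t - c * s) (B : Set (ℝ × ℝ)) (p : ℤ × ℤ) :
    p ∈ LP d c ((fun p : ℝ × ℝ => ((s:ℝ) - p.1, (t:ℝ) - p.2)) ⁻¹' B) ↔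
      (s - p.1, t - p.2) ∈ LP d c B := by
  unfold LP
  simp only [Set.mem_ofPred_eq, Set.mem_preimage]
  push_cast
  refine and_congr ?_ Iff.rfl
  have e : t - p.2 - c * (s - p.1) = (t - c * s) - (p.2 - c * p.1) := by ring
  rw [e]
  exact (dvd_sub_right hst).symm

lemma refl_convex (s t : ℤ) (B : Set (ℝ × ℝ)) (hB : Convex ℝ B) :
    Convex ℝ ((fun p : ℝ × ℝ => ((s:ℝ) - p.1, (t:ℝ) - p.2)) ⁻¹' B) := by
  intro p hp q hq a b ha hb hab
  have := hB hp hq ha hb hab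
  simp only [Set.mem_preimage]
  convert this using 1
  ext
  · simp; linear_combination (s:ℝ) * (-hab)
  · simp; linear_combination (t:ℝ) * (-hab)

lemma refl_finite (d c s t : ℤ) (hst : d ∣ t - c * s) (B : Set (ℝ × ℝ)) (hfin : (LP d c B).Finite) :
    (LP d c ((fun p : ℝ × ℝ => ((s:ℝ) - p.1, (t:ℝ) - p.2)) ⁻¹' B)).Finite := by
  refine (hfin.preimage (f := fun p : ℤ × ℤ => (s - p.1, t - p.2))
        (fun p _ q _ h => by simp at h; exact Prod.ext h.1 h.2)).subset
        (fun p hp => (refl_LP d c s t hst B p).1 hp)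

lemma key_coord (d c j : ℤ) (hd : 2 ≤ d) (hc : 0 < c) (hcd : c < d) (hj : 0 < j) (hjd : j < d)
    (hjc : d ∣ j * c - 1) (A B : Set (ℝ × ℝ)) (hA : Convex ℝ A) (hB : Convex ℝ B)
    (hfinA : (LP d c A).Finite) (hfinB : (LP d c B).Finite)
    (hA0 : ((0:ℝ), (0:ℝ)) ∈ A) (hA1 : ((d:ℝ), (0:ℝ)) ∈ A)
    (hB0 : ((0:ℝ), (0:ℝ)) ∈ B) (hB1 : ((0:ℝ), (d:ℝ)) ∈ B)
    (hSA : ∀ p ∈ LP d c A, p.1 ≤ 0 ∨ d ≤ p.1)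
    (hSB : ∀ p ∈ LP d c B, p.2 ≤ 0 ∨ d ≤ p.2)
    (href : RefC d c A B) : False := by
  have hstB : d ∣ d - c * 0 := by simp
  have hstA : d ∣ 0 - c * d := by simp
  set B' : Set (ℝ × ℝ) := (fun p : ℝ × ℝ => (((0:ℤ):ℝ) - p.1, (d:ℝ) - p.2)) ⁻¹' B with hB'
  set A' : Set (ℝ × ℝ) := (fun p : ℝ × ℝ => ((d:ℝ) - p.1, ((0:ℤ):ℝ) - p.2)) ⁻¹' A with hA'
  have hmB : ∀ p, p ∈ LP d c B' ↔ (0 - p.1, d - p.2) ∈ LP d c B := refl_LP d c 0 d hstB B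
  have hmA : ∀ p, p ∈ LP d c A' ↔ (d - p.1, 0 - p.2) ∈ LP d c A := refl_LP d c d 0 hstA A
  have hmB' : ∀ p, p ∈ LP d c B → (0 - p.1, d - p.2) ∈ LP d c B' := by
    intro p hp; rw [hmB]; simpa using hp
  have hmA' : ∀ p, p ∈ LP d c A → (d - p.1, 0 - p.2) ∈ LP d c A' := by
    intro p hp; rw [hmA]; simpa using hp
  have hB0' : ((0:ℝ), (0:ℝ)) ∈ B' := by simpa [hB'] using hB1
  have hB1' : ((0:ℝ), (d:ℝ)) ∈ B' := by simpa [hB'] using hB0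
  have hA0' : ((0:ℝ), (0:ℝ)) ∈ A' := by simpa [hA'] using hA1
  have hA1' : ((d:ℝ), (0:ℝ)) ∈ A' := by simpa [hA'] using hA0
  have hSB' : ∀ p ∈ LP d c B', p.2 ≤ 0 ∨ d ≤ p.2 := by
    intro p hp
    rcases hSB _ ((hmB p).1 hp) with h | h <;> simp only at h
    · right; omega
    · left; omega
  have hSA' : ∀ p ∈ LP d c A', p.1 ≤ 0 ∨ d ≤ p.1 := by
    intro p hp
    rcases hSA _ ((hmA p).1 hp) with h | h <;> simp only at h
    · right; omega
    · left; omega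
  obtain ⟨r0, r, hr0, hrd, hrc, hR⟩ := right_line d c j hd hc hcd hjc B hB hfinB hB0 hB1 hSB
  obtain ⟨m0, m, hm0, hmd, hmc, hM⟩ := right_line d c j hd hc hcd hjc B'
    (refl_convex 0 d B hB) (refl_finite d c 0 d hstB B hfinB) hB0' hB1' hSB'
  -- L(y) = -(m0 + m (d - y)) = (-m0 - m d) + m y
  have hL : ∀ q ∈ LP d c B, (-m0 - m * d) + m * q.2 ≤ (q.1 : ℝ) := by
    intro q hq
    have := hM _ (hmB' q hq)
    push_cast at this
    linarith
  rcases le_total r m with h | h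
  · exact key_top d c j hd hc hcd hj hjd hjc A B hA hfinA hA0 hA1 hB1 hSA hSB href
      (-m0 - m * d) m r0 r hR hL hr0 hrd (by linarith) (by linarith) hrc (by linarith) h
  · refine key_top d c j hd hc hcd hj hjd hjc A' B' (refl_convex d 0 A hA)
      (refl_finite d c d 0 hstA A hfinA) hA0' hA1' hB1' hSA' hSB' ?_
      (-r0 - r * d) r m0 m hM ?_ hm0 hmd (by linarith) (by linarith) hmc (by linarith) h
    · intro x hx x' hx' hne htop
      obtain ⟨y, hy, y', hy', hyne, hpar, hytop⟩ := href _ ((hmA x).1 hx) _ ((hmA x').1 hx')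
        (by intro h; simp at h; exact hne (Prod.ext h.1 h.2)) (by
          intro p hp
          have h1 := htop _ (hmA' p hp)
          have h2 := htop x' hx'
          simp only at h1 h2 ⊢
          linarith)
      refine ⟨_, hmB' _ hy, _, hmB' _ hy', ?_, ?_, ?_⟩
      · intro h; simp at h; exact hyne (Prod.ext h.1 h.2)
      · simp only at hpar ⊢; linarith
      · intro q hq
        have := hytop _ ((hmB q).1 hq)
        simp only at this ⊢
        linarith
    · intro q hq
      have := hR _ ((hmB q).1 hq)
      push_cast at this
      linarith


def ZP (A : Set (ℝ × ℝ)) : Set (ℤ × ℤ) := {p | ((p.1 : ℝ), (p.2 : ℝ)) ∈ A}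

def Ref2 (A B : Set (ℝ × ℝ)) : Prop :=
  ∀ x ∈ ZP A, ∀ x' ∈ ZP A, x ≠ x' →
    (∀ p ∈ ZP A, (x'.1 - x.1) * (p.2 - x.2) ≤ (x'.2 - x.2) * (p.1 - x.1)) →
    ∃ y ∈ ZP B, ∃ y' ∈ ZP B, y ≠ y' ∧
      (x'.1 - x.1) * (y'.2 - y.2) = (x'.2 - x.2) * (y'.1 - y.1) ∧
      ∀ q ∈ ZP B, (x'.1 - x.1) * (q.2 - y.2) ≤ (x'.2 - x.2) * (q.1 - y.1)

lemma seg_mem (A : Set (ℝ × ℝ)) (hA : Convex ℝ A) (a a' : ℤ × ℤ) (ha : a ∈ ZP A) (ha' : a' ∈ ZP A)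
    (g : ℤ) (hg : 2 ≤ g) (m : ℤ × ℤ) (h1 : a'.1 - a.1 = g * m.1) (h2 : a'.2 - a.2 = g * m.2) :
    (a.1 + m.1, a.2 + m.2) ∈ ZP A := by
  have hgR : (2:ℝ) ≤ g := by exact_mod_cast hg
  have := hA ha ha' (a := 1 - 1 / (g:ℝ)) (b := 1 / (g:ℝ))
    (by rw [sub_nonneg, div_le_one (by linarith)]; linarith) (by positivity) (by ring)
  have e1 : (a'.1:ℝ) = a.1 + g * m.1 := by
    have : a'.1 = a.1 + g * m.1 := by linarith
    exact_mod_cast this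
  have e2 : (a'.2:ℝ) = a.2 + g * m.2 := by
    have : a'.2 = a.2 + g * m.2 := by linarith
    exact_mod_cast this
  show ((_ : ℝ), (_ : ℝ)) ∈ A
  convert this using 1
  ext
  · simp [e1]; field_simp; ring
  · simp [e2]; field_simp; ring

noncomputable def psi (a w v : ℤ × ℤ) (d c : ℤ) (p : ℝ × ℝ) : ℝ × ℝ :=
  (a.1 + p.1 * w.1 + (p.2 - c * p.1) / d * v.1, a.2 + p.1 * w.2 + (p.2 - c * p.1) / d * v.2)

lemma psi_convex (a w v : ℤ × ℤ) (d c : ℤ) (A : Set (ℝ × ℝ)) (hA : Convex ℝ A) :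
    Convex ℝ (psi a w v d c ⁻¹' A) := by
  intro p hp q hq s t hs ht hst
  have := hA hp hq hs ht hst
  show _ ∈ A
  convert this using 1
  ext
  · simp [psi]; linear_combination (a.1:ℝ) * (-hst)
  · simp [psi]; linear_combination (a.2:ℝ) * (-hst)

def pz (a w v : ℤ × ℤ) (d c : ℤ) (p : ℤ × ℤ) : ℤ × ℤ :=
  (a.1 + p.1 * w.1 + (p.2 - c * p.1) / d * v.1, a.2 + p.1 * w.2 + (p.2 - c * p.1) / d * v.2)

lemma pz_mem (a w v : ℤ × ℤ) (d c : ℤ) (hd : 2 ≤ d) (A : Set (ℝ × ℝ)) (p : ℤ × ℤ)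
    (hp : p ∈ LP d c (psi a w v d c ⁻¹' A)) : pz a w v d c p ∈ ZP A := by
  obtain ⟨⟨n, hn⟩, hp⟩ := hp
  have hn' : (p.2:ℝ) - c * p.1 = d * n := by exact_mod_cast hn
  have hd' : (d:ℝ) ≠ 0 := by
    have : d ≠ 0 := by omega
    exact_mod_cast this
  have e : (p.2 - c * p.1) / d = n := by rw [hn]; exact Int.mul_ediv_cancel_left _ (by omega)
  show (((pz a w v d c p).1 : ℝ), ((pz a w v d c p).2 : ℝ)) ∈ A
  simp only [Set.mem_preimage, psi] at hp
  rw [hn', mul_div_cancel_left₀ _ hd'] at hp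
  simp only [pz, e]
  push_cast
  exact hp

/-- coordinates of a lattice point -/
def cz (a w v : ℤ × ℤ) (d c : ℤ) (p : ℤ × ℤ) : ℤ × ℤ :=
  ((p.1 - a.1) * v.2 - (p.2 - a.2) * v.1,
    c * ((p.1 - a.1) * v.2 - (p.2 - a.2) * v.1) + d * (w.1 * (p.2 - a.2) - w.2 * (p.1 - a.1)))

lemma cz_mem (a w v : ℤ × ℤ) (d c : ℤ) (hd : 2 ≤ d) (hw : w.1 * v.2 - w.2 * v.1 = 1)
    (A : Set (ℝ × ℝ)) (p : ℤ × ℤ) (hp : p ∈ ZP A) :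
    cz a w v d c p ∈ LP d c (psi a w v d c ⁻¹' A) := by
  have hd' : (d:ℝ) ≠ 0 := by
    have : d ≠ 0 := by omega
    exact_mod_cast this
  have hwR : (w.1:ℝ) * v.2 - w.2 * v.1 = 1 := by exact_mod_cast hw
  refine ⟨by simp [cz], ?_⟩
  show _ ∈ A
  have : ((p.1 : ℝ), (p.2 : ℝ)) ∈ A := hp
  convert this using 1
  simp only [cz, psi]
  push_cast
  ext
  · simp only [add_sub_cancel_left, mul_div_cancel_left₀ _ hd']
    linear_combination ((p.1:ℝ) - a.1) * hwR
  · simp only [add_sub_cancel_left, mul_div_cancel_left₀ _ hd']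
    linear_combination ((p.2:ℝ) - a.2) * hwR

lemma pz_inj (a w v : ℤ × ℤ) (d c : ℤ) (hd : 2 ≤ d) (hw : w.1 * v.2 - w.2 * v.1 = 1)
    (p q : ℤ × ℤ) (hp : d ∣ p.2 - c * p.1) (hq : d ∣ q.2 - c * q.1)
    (h : pz a w v d c p = pz a w v d c q) : p = q := by
  obtain ⟨n, hn⟩ := hp
  obtain ⟨m, hm⟩ := hq
  simp only [pz, hn, hm, Int.mul_ediv_cancel_left _ (show d ≠ 0 by omega), Prod.mk.injEq] at h
  have h1 : p.1 = q.1 := by linear_combination v.2 * h.1 - v.1 * h.2 - (p.1 - q.1) * hw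
  have h2 : n = m := by linear_combination w.1 * h.2 - w.2 * h.1 - (n - m) * hw
  refine Prod.ext h1 ?_
  rw [h1, h2] at hn
  linarith

lemma psi_finite (a w v : ℤ × ℤ) (d c : ℤ) (hd : 2 ≤ d) (hw : w.1 * v.2 - w.2 * v.1 = 1)
    (A : Set (ℝ × ℝ)) (hfin : (ZP A).Finite) : (LP d c (psi a w v d c ⁻¹' A)).Finite := by
  apply Set.Finite.of_finite_image (f := pz a w v d c)
  · apply hfin.subset
    rintro _ ⟨p, hp, rfl⟩
    exact pz_mem a w v d c hd A p hp
  · intro p hp q hq h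
    exact pz_inj a w v d c hd hw p q hp.1 hq.1 h

lemma cross_pz (a w v : ℤ × ℤ) (d c : ℤ) (hd : 2 ≤ d) (hw : w.1 * v.2 - w.2 * v.1 = 1)
    (p q r s : ℤ × ℤ) (hp : d ∣ p.2 - c * p.1) (hq : d ∣ q.2 - c * q.1)
    (hr : d ∣ r.2 - c * r.1) (hs : d ∣ s.2 - c * s.1) (b : ℤ × ℤ) :
    d * (((pz a w v d c q).1 - (pz a w v d c p).1) * ((pz b w v d c s).2 - (pz b w v d c r).2)
      - ((pz a w v d c q).2 - (pz a w v d c p).2) * ((pz b w v d c s).1 - (pz b w v d c r).1))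
    = (q.1 - p.1) * (s.2 - r.2) - (q.2 - p.2) * (s.1 - r.1) := by
  obtain ⟨n1, h1⟩ := hp
  obtain ⟨n2, h2⟩ := hq
  obtain ⟨n3, h3⟩ := hr
  obtain ⟨n4, h4⟩ := hs
  simp only [pz, h1, h2, h3, h4, Int.mul_ediv_cancel_left _ (show d ≠ 0 by omega)]
  have e1 : p.2 = d * n1 + c * p.1 := by linarith
  have e2 : q.2 = d * n2 + c * q.1 := by linarith
  have e3 : r.2 = d * n3 + c * r.1 := by linarith
  have e4 : s.2 = d * n4 + c * s.1 := by linarith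
  rw [e1, e2, e3, e4]
  linear_combination (d * ((q.1 - p.1) * (n4 - n3) - (n2 - n1) * (s.1 - r.1))) * hw

lemma pz_cz (a w v : ℤ × ℤ) (d c : ℤ) (hd : 2 ≤ d) (hw : w.1 * v.2 - w.2 * v.1 = 1) (p : ℤ × ℤ) :
    pz a w v d c (cz a w v d c p) = p := by
  simp only [pz, cz, add_sub_cancel_left, Int.mul_ediv_cancel_left _ (show d ≠ 0 by omega)]
  ext
  · simp only; linear_combination (p.1 - a.1) * hw
  · simp only; linear_combination (p.2 - a.2) * hw

lemma key2d (A B : Set (ℝ × ℝ)) (hA : Convex ℝ A) (hB : Convex ℝ B)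
    (hfinA : (ZP A).Finite) (hfinB : (ZP B).Finite) (href : Ref2 A B)
    (a a' b b' : ℤ × ℤ) (ha : a ∈ ZP A) (ha' : a' ∈ ZP A) (hb : b ∈ ZP B) (hb' : b' ∈ ZP B)
    (d : ℤ) (hdd : d = (a'.1 - a.1) * (b'.2 - b.2) - (a'.2 - a.2) * (b'.1 - b.1)) (hd : 2 ≤ d) :
    (∃ q ∈ ZP B, 0 < (a'.1 - a.1) * (q.2 - b.2) - (a'.2 - a.2) * (q.1 - b.1) ∧
      (a'.1 - a.1) * (q.2 - b.2) - (a'.2 - a.2) * (q.1 - b.1) < d) ∨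
    (∃ p ∈ ZP A, 0 < (p.1 - a.1) * (b'.2 - b.2) - (p.2 - a.2) * (b'.1 - b.1) ∧
      (p.1 - a.1) * (b'.2 - b.2) - (p.2 - a.2) * (b'.1 - b.1) < d) := by
  by_contra hcon
  rw [not_or] at hcon
  obtain ⟨hq, hp⟩ := hcon
  push Not at hq hp
  set u : ℤ × ℤ := (a'.1 - a.1, a'.2 - a.2) with hu
  set v : ℤ × ℤ := (b'.1 - b.1, b'.2 - b.2) with hv
  have hdd' : d = u.1 * v.2 - u.2 * v.1 := hdd
  have hq' : ∀ q ∈ ZP B, 0 < u.1 * (q.2 - b.2) - u.2 * (q.1 - b.1) →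
    d ≤ u.1 * (q.2 - b.2) - u.2 * (q.1 - b.1) := hq
  have hp' : ∀ p ∈ ZP A, 0 < (p.1 - a.1) * v.2 - (p.2 - a.2) * v.1 →
    d ≤ (p.1 - a.1) * v.2 - (p.2 - a.2) * v.1 := hp
  have small : ∀ g t : ℤ, 2 ≤ g → d = g * t → 0 < t ∧ t < d := by
    intro g t hg h
    have : 0 < t := by
      by_contra h'; push Not at h'; nlinarith
    exact ⟨this, by nlinarith⟩
  have hgv : IsCoprime v.1 v.2 := by
    rw [Int.isCoprime_iff_gcd_eq_one]
    by_contra hne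
    have hg0 : Int.gcd v.1 v.2 ≠ 0 := by
      intro h
      rw [Int.gcd_eq_zero_iff] at h
      rw [h.1, h.2] at hdd'; omega
    obtain ⟨m1, hm1⟩ := Int.gcd_dvd_left v.1 v.2
    obtain ⟨m2, hm2⟩ := Int.gcd_dvd_right v.1 v.2
    have hg2 : (2:ℤ) ≤ (Int.gcd v.1 v.2 : ℤ) := by omega
    generalize (Int.gcd v.1 v.2 : ℤ) = g at *
    have hmem := seg_mem B hB b b' hb hb' g hg2 (m1, m2) hm1 hm2
    obtain ⟨s1, s2⟩ := small g (u.1 * m2 - u.2 * m1) hg2 (by rw [hdd', hm1, hm2]; ring)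
    have := hq' _ hmem (by simpa using s1)
    simp at this
    omega
  have hgu : IsCoprime u.1 u.2 := by
    rw [Int.isCoprime_iff_gcd_eq_one]
    by_contra hne
    have hg0 : Int.gcd u.1 u.2 ≠ 0 := by
      intro h
      rw [Int.gcd_eq_zero_iff] at h
      rw [h.1, h.2] at hdd'; omega
    obtain ⟨m1, hm1⟩ := Int.gcd_dvd_left u.1 u.2
    obtain ⟨m2, hm2⟩ := Int.gcd_dvd_right u.1 u.2
    have hg2 : (2:ℤ) ≤ (Int.gcd u.1 u.2 : ℤ) := by omega
    generalize (Int.gcd u.1 u.2 : ℤ) = g at *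
    have hmem := seg_mem A hA a a' ha ha' g hg2 (m1, m2) hm1 hm2
    obtain ⟨s1, s2⟩ := small g (m1 * v.2 - m2 * v.1) hg2 (by rw [hdd', hm1, hm2]; ring)
    have := hp' _ hmem (by simpa using s1)
    simp at this
    omega
  clear_value u v
  -- w
  obtain ⟨s, t, hst⟩ := hgv
  -- w0 = (t, -s)
  set c0 : ℤ := u.1 * (-s) - u.2 * t with hc0
  -- w = w0 - k v with cross(u,w) = c0 - k d
  set k : ℤ := c0 / d with hk
  set w : ℤ × ℤ := (t - k * v.1, -s - k * v.2) with hw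
  set c : ℤ := c0 % d with hc
  have hwv : w.1 * v.2 - w.2 * v.1 = 1 := by simp only [hw]; linear_combination hst
  have huw : u.1 * w.2 - u.2 * w.1 = c := by
    have : d * k + c = c0 := Int.mul_ediv_add_emod c0 d
    simp only [hw]
    linear_combination (-this) + k * hdd'
  have hc_nonneg : 0 ≤ c := Int.emod_nonneg _ (by omega)
  have hc_lt : c < d := Int.emod_lt_of_pos _ (by omega)
  clear_value w c
  have hu1 : u.1 = d * w.1 - c * v.1 := by
    linear_combination (-u.1) * hwv - w.1 * hdd' - v.1 * huw
  have hu2 : u.2 = d * w.2 - c * v.2 := by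
    linear_combination (-u.2) * hwv - w.2 * hdd' - v.2 * huw
  have hcop : IsCoprime c d := by
    obtain ⟨x, y, hxy⟩ := hgu
    refine ⟨-(x * v.1 + y * v.2), x * w.1 + y * w.2, ?_⟩
    rw [hu1, hu2] at hxy
    linear_combination hxy
  have hc_pos : 0 < c := by
    rcases hc_nonneg.lt_or_eq with h | h
    · exact h
    · exfalso
      rw [← h] at hcop
      obtain ⟨x, y, hxy⟩ := hcop
      have : d ∣ 1 := ⟨y, by linarith⟩
      have := Int.le_of_dvd one_pos this
      omega
  obtain ⟨j, hj, hjd, hjc⟩ : ∃ j, 0 < j ∧ j < d ∧ d ∣ j * c - 1 := by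
    obtain ⟨x, y, hxy⟩ := hcop
    have h1 : d ∣ (x % d) * c - 1 := by
      have : d * (x / d) + x % d = x := Int.mul_ediv_add_emod x d
      refine ⟨-y - (x / d) * c, ?_⟩
      linear_combination hxy + c * this
    have h2 : 0 ≤ x % d := Int.emod_nonneg _ (by omega)
    refine ⟨x % d, ?_, Int.emod_lt_of_pos _ (by omega), h1⟩
    rcases h2.lt_or_eq with h | h
    · exact h
    · exfalso
      rw [← h] at h1
      have h1 : d ∣ 1 := by simpa using h1
      have := Int.le_of_dvd one_pos h1
      omega
  have hdR : (d:ℝ) ≠ 0 := by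
    have : d ≠ 0 := by omega
    exact_mod_cast this
  have hu1R : (u.1:ℝ) = d * w.1 - c * v.1 := by exact_mod_cast hu1
  have hu2R : (u.2:ℝ) = d * w.2 - c * v.2 := by exact_mod_cast hu2
  refine key_coord d c j hd hc_pos hc_lt hj hjd hjc (psi a w v d c ⁻¹' A) (psi b w v d c ⁻¹' B)
    (psi_convex _ _ _ _ _ _ hA) (psi_convex _ _ _ _ _ _ hB)
    (psi_finite _ _ _ _ _ hd hwv _ hfinA) (psi_finite _ _ _ _ _ hd hwv _ hfinB)
    ?_ ?_ ?_ ?_ ?_ ?_ ?_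
  · have : ((a.1:ℝ), (a.2:ℝ)) ∈ A := ha
    simpa [psi] using this
  · have : ((a'.1:ℝ), (a'.2:ℝ)) ∈ A := ha'
    have e1 : (u.1:ℝ) = a'.1 - a.1 := by rw [hu]; push_cast; ring
    have e2 : (u.2:ℝ) = a'.2 - a.2 := by rw [hu]; push_cast; ring
    show _ ∈ A
    convert this using 1
    ext
    · simp [psi]; field_simp; linear_combination e1 - hu1R
    · simp [psi]; field_simp; linear_combination e2 - hu2R
  · have : ((b.1:ℝ), (b.2:ℝ)) ∈ B := hb
    simpa [psi] using this
  · have : ((b'.1:ℝ), (b'.2:ℝ)) ∈ B := hb'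
    have e1 : (v.1:ℝ) = b'.1 - b.1 := by rw [hv]; push_cast; ring
    have e2 : (v.2:ℝ) = b'.2 - b.2 := by rw [hv]; push_cast; ring
    show _ ∈ B
    convert this using 1
    ext
    · simp [psi]; field_simp; linear_combination e1
    · simp [psi]; field_simp; linear_combination e2
  · intro p hpm
    have h1 := hp' _ (pz_mem _ _ _ _ _ hd _ _ hpm)
    obtain ⟨n, hn⟩ := hpm.1
    simp only [pz, hn, Int.mul_ediv_cancel_left _ (show d ≠ 0 by omega)] at h1
    have e : (a.1 + p.1 * w.1 + n * v.1 - a.1) * v.2 - (a.2 + p.1 * w.2 + n * v.2 - a.2) * v.1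
      = p.1 := by linear_combination p.1 * hwv
    rw [e] at h1
    omega
  · intro p hpm
    have h1 := hq' _ (pz_mem _ _ _ _ _ hd _ _ hpm)
    obtain ⟨n, hn⟩ := hpm.1
    simp only [pz, hn, Int.mul_ediv_cancel_left _ (show d ≠ 0 by omega)] at h1
    have e : u.1 * (b.2 + p.1 * w.2 + n * v.2 - b.2) - u.2 * (b.1 + p.1 * w.1 + n * v.1 - b.1)
      = p.2 := by linear_combination p.1 * huw - n * hdd' - hn
    rw [e] at h1
    omega
  · intro x hx x' hx' hne htop
    obtain ⟨y, hy, y', hy', hyne, hpar, hytop⟩ := href _ (pz_mem _ _ _ _ _ hd _ _ hx) _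
      (pz_mem _ _ _ _ _ hd _ _ hx') (fun h => hne (pz_inj _ _ _ _ _ hd hwv _ _ hx.1 hx'.1 h)) (by
        intro p hpA
        have h1 := cz_mem a w v d c hd hwv A p hpA
        have h2 := htop _ h1
        have h3 := cross_pz a w v d c hd hwv x x' x (cz a w v d c p) hx.1 hx'.1 hx.1 h1.1 a
        rw [pz_cz a w v d c hd hwv] at h3
        nlinarith)
    have hy1 := cz_mem b w v d c hd hwv B y hy
    have hy1' := cz_mem b w v d c hd hwv B y' hy'
    refine ⟨_, hy1, _, hy1', ?_, ?_, ?_⟩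
    · intro h
      have := congrArg (pz b w v d c) h
      rw [pz_cz b w v d c hd hwv, pz_cz b w v d c hd hwv] at this
      exact hyne this
    · have h3 := cross_pz a w v d c hd hwv x x' _ _ hx.1 hx'.1 hy1.1 hy1'.1 b
      rw [pz_cz b w v d c hd hwv, pz_cz b w v d c hd hwv] at h3
      rw [sub_eq_zero.2 hpar] at h3
      linarith
    · intro q hqm
      have h3 := cross_pz a w v d c hd hwv x x' _ q hx.1 hx'.1 hy1.1 hqm.1 b
      rw [pz_cz b w v d c hd hwv] at h3
      have := hytop _ (pz_mem _ _ _ _ _ hd _ _ hqm)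
      nlinarith


lemma mem_hull_range {ι E : Type*} [Fintype ι] [AddCommGroup E] [Module ℝ E] (v : ι → E) (x : E) :
    x ∈ convexHull ℝ (Set.range v) ↔
      ∃ l : ι → ℝ, (∀ i, 0 ≤ l i) ∧ ∑ i, l i = 1 ∧ ∑ i, l i • v i = x := by
  classical
  constructor
  · intro hx
    have hc : Convex ℝ {x : E | ∃ l : ι → ℝ, (∀ i, 0 ≤ l i) ∧ ∑ i, l i = 1 ∧
        ∑ i, l i • v i = x} := by
      rintro _ ⟨l, h1, h2, rfl⟩ _ ⟨m, h3, h4, rfl⟩ s t hs ht hst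
      refine ⟨fun i => s * l i + t * m i, fun i => ?_, ?_, ?_⟩
      · have := h1 i; have := h3 i; positivity
      · rw [Finset.sum_add_distrib, ← Finset.mul_sum, ← Finset.mul_sum, h2, h4]; linarith
      · simp only [add_smul, mul_smul, Finset.sum_add_distrib, Finset.smul_sum]
    refine convexHull_min ?_ hc hx
    rintro _ ⟨i, rfl⟩
    refine ⟨Pi.single i 1, fun j => ?_, by simp, ?_⟩
    · by_cases h : j = i
      · subst h; simp
      · simp [h]
    · rw [Finset.sum_eq_single i]
      · simp
      · intro j _ h; simp [h]
      · simp
  · rintro ⟨l, h1, h2, h3⟩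
    exact mem_convexHull_of_exists_fintype l v h1 h2 (fun i => ⟨i, rfl⟩) h3

/-- general replacement step: x = s m + sum of nonneg coefficients with i-th zero -/
lemma hull_update {ι E : Type*} [Fintype ι] [DecidableEq ι] [AddCommGroup E] [Module ℝ E]
    (v : ι → E) (m x : E)
    (nu mu : ι → ℝ) (hnu : ∑ i, nu i = 1) (hx : ∑ i, nu i • v i = x)
    (hmu : ∑ i, mu i = 1) (hm : ∑ i, mu i • v i = m)
    (s : ℝ) (hs : 0 ≤ s) (i : ι) (hi : nu i - s * mu i = 0) (hj : ∀ j, 0 ≤ nu j - s * mu j) :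
    x ∈ convexHull ℝ (Set.range (Function.update v i m)) := by
  rw [mem_hull_range]
  refine ⟨Function.update (fun j => nu j - s * mu j) i s, ?_, ?_, ?_⟩
  · intro j
    by_cases h : j = i
    · subst h; simpa using hs
    · simpa [h] using hj j
  · rw [Finset.sum_update_of_mem (Finset.mem_univ i)]
    have : ∑ j, (nu j - s * mu j) = 1 - s := by
      rw [Finset.sum_sub_distrib, ← Finset.mul_sum, hnu, hmu]; ring
    have h2 := Finset.add_sum_erase Finset.univ (fun j => nu j - s * mu j) (Finset.mem_univ i)
    rw [Finset.sdiff_singleton_eq_erase]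
    linarith
  · have h2 := Finset.add_sum_erase Finset.univ
      (fun j => Function.update (fun j => nu j - s * mu j) i s j • Function.update v i m j)
      (Finset.mem_univ i)
    have h3 := Finset.add_sum_erase Finset.univ
      (fun j => (nu j - s * mu j) • v j) (Finset.mem_univ i)
    have h4 : ∑ j, (nu j - s * mu j) • v j = x - s • m := by
      simp only [sub_smul, mul_smul, Finset.sum_sub_distrib, ← Finset.smul_sum, hx, hm]
    rw [← h2]
    have h5 : ∑ j ∈ Finset.univ.erase i,
        Function.update (fun j => nu j - s * mu j) i s j • Function.update v i m j
        = ∑ j ∈ Finset.univ.erase i, (nu j - s * mu j) • v j := by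
      apply Finset.sum_congr rfl
      intro j hj
      have : j ≠ i := Finset.ne_of_mem_erase hj
      simp [this]
    rw [h5]
    simp only [hi, zero_smul, zero_add] at h3
    rw [h3, h4]
    simp

lemma pivot_in {ι E : Type*} [Fintype ι] [DecidableEq ι] [AddCommGroup E] [Module ℝ E]
    (v : ι → E) (m x : E) (hx : x ∈ convexHull ℝ (Set.range v))
    (mu : ι → ℝ) (hmu : ∑ i, mu i = 1) (hm : ∑ i, mu i • v i = m) :
    ∃ i, 0 < mu i ∧ x ∈ convexHull ℝ (Set.range (Function.update v i m)) := by
  rw [mem_hull_range] at hx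
  obtain ⟨l, h1, h2, h3⟩ := hx
  have hne : (Finset.univ.filter (fun i => 0 < mu i)).Nonempty := by
    by_contra h
    rw [Finset.not_nonempty_iff_eq_empty, Finset.filter_eq_empty_iff] at h
    have : ∑ i, mu i ≤ 0 := Finset.sum_nonpos (fun i hi => not_lt.1 (h hi))
    linarith
  obtain ⟨i, hi, hmin⟩ := Finset.exists_min_image _ (fun i => l i / mu i) hne
  have hi0 : 0 < mu i := (Finset.mem_filter.1 hi).2
  refine ⟨i, hi0, hull_update v m x l mu h2 h3 hmu hm (l i / mu i)
    (div_nonneg (h1 i) hi0.le) i (by field_simp; ring) ?_⟩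
  intro j
  rcases le_or_gt (mu j) 0 with h | h
  · have := div_nonneg (h1 i) hi0.le
    have := h1 j
    nlinarith
  · have := hmin j (by simp [h])
    rw [le_div_iff₀ h] at this
    linarith

lemma pivot_out {ι E : Type*} [Fintype ι] [DecidableEq ι] [AddCommGroup E] [Module ℝ E]
    (v : ι → E) (m y x : E) (hy : y ∈ convexHull ℝ (Set.range v)) (hxy : x ∈ segment ℝ m y)
    (mu : ι → ℝ) (hmu : ∑ i, mu i = 1) (hm : ∑ i, mu i • v i = m) :
    x ∈ convexHull ℝ (Set.range v) ∨
    ∃ i, mu i ≠ 0 ∧ x ∈ convexHull ℝ (Set.range (Function.update v i m)) := by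
  rw [mem_hull_range] at hy
  obtain ⟨l, h1, h2, h3⟩ := hy
  obtain ⟨t, r, ht, hr, htr, hx⟩ := hxy
  set nu : ι → ℝ := fun i => t * mu i + r * l i with hnu
  have hnu1 : ∑ i, nu i = 1 := by
    simp only [hnu, Finset.sum_add_distrib, ← Finset.mul_sum, hmu, h2]; linarith
  have hnux : ∑ i, nu i • v i = x := by
    simp only [hnu, add_smul, mul_smul, Finset.sum_add_distrib, ← Finset.smul_sum, hm, h3, hx]
  by_cases hpos : ∀ i, 0 ≤ nu i
  · left
    rw [mem_hull_range]
    exact ⟨nu, hpos, hnu1, hnux⟩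
  · right
    push Not at hpos
    obtain ⟨i0, hi0⟩ := hpos
    have hneg : ∀ i, nu i < 0 → mu i < 0 := by
      intro i hi
      by_contra h
      push Not at h
      have : 0 ≤ t * mu i + r * l i := by have := h1 i; positivity
      exact absurd hi (not_lt.2 this)
    have hne : (Finset.univ.filter (fun i => mu i < 0)).Nonempty :=
      ⟨i0, by simp [hneg i0 hi0]⟩
    obtain ⟨i, hi, hmax⟩ := Finset.exists_max_image _ (fun i => nu i / mu i) hne
    have himu : mu i < 0 := (Finset.mem_filter.1 hi).2
    have hs0 : 0 ≤ nu i / mu i :=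
      le_trans (div_pos_of_neg_of_neg hi0 (hneg i0 hi0)).le (hmax i0 (by simp [hneg i0 hi0]))
    refine ⟨i, himu.ne, hull_update v m x nu mu hnu1 hnux hmu hm (nu i / mu i) hs0 i ?_ ?_⟩
    · rw [div_mul_cancel₀ _ himu.ne, sub_self]
    · intro j
      rcases lt_or_ge (mu j) 0 with h | h
      · have := hmax j (by simp [h])
        rw [div_le_iff_of_neg h] at this
        linarith
      · have hle : nu i / mu i ≤ t := by
          rw [div_le_iff_of_neg himu]
          have := mul_nonneg hr (h1 i)
          simp only [hnu]; linarith
        have : nu i / mu i * mu j ≤ t * mu j := mul_le_mul_of_nonneg_right hle h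
        have := mul_nonneg hr (h1 j)
        have e : nu j = t * mu j + r * l j := rfl
        linarith

/-- normalized volume -/
def Dv (v : Fin 4 → Fin 3 → ℤ) : ℤ := (Matrix.of ![v 1 - v 0, v 2 - v 0, v 3 - v 0]).det

lemma Dv_eq (v : Fin 4 → Fin 3 → ℤ) : Dv v =
    (v 1 0 - v 0 0) * ((v 2 1 - v 0 1) * (v 3 2 - v 0 2) - (v 2 2 - v 0 2) * (v 3 1 - v 0 1))
    - (v 1 1 - v 0 1) * ((v 2 0 - v 0 0) * (v 3 2 - v 0 2) - (v 2 2 - v 0 2) * (v 3 0 - v 0 0))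
    + (v 1 2 - v 0 2) * ((v 2 0 - v 0 0) * (v 3 1 - v 0 1) - (v 2 1 - v 0 1) * (v 3 0 - v 0 0)) := by
  simp [Dv, Matrix.det_fin_three]; ring

lemma Dv_sum (v : Fin 4 → Fin 3 → ℤ) (m : Fin 3 → ℤ) :
    ∑ i, Dv (Function.update v i m) = Dv v := by
  simp [Fin.sum_univ_four, Dv_eq, Function.update]
  ring

lemma Dv_comb (v : Fin 4 → Fin 3 → ℤ) (m : Fin 3 → ℤ) (k : Fin 3) :
    ∑ i, Dv (Function.update v i m) * v i k = Dv v * m k := by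
  simp [Fin.sum_univ_four, Dv_eq, Function.update]
  fin_cases k <;> simp <;> ring

lemma Dv_perm (v : Fin 4 → Fin 3 → ℤ) (σ : Equiv.Perm (Fin 4)) :
    |Dv (v ∘ σ)| = |Dv v| := by
  have key : ∀ v : Fin 4 → Fin 3 → ℤ,
      Dv v = (Matrix.of (fun i => ![1, v i 0, v i 1, v i 2])).det := by
    intro v
    rw [Dv_eq, Matrix.det_succ_row_zero]
    simp [Fin.sum_univ_four, Matrix.det_fin_three, Fin.succAbove]
    ring
  rw [key, key]
  have := Matrix.det_permute σ (Matrix.of (fun i => ![1, v i 0, v i 1, v i 2]))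
  have h2 : (Matrix.of (fun i => ![1, v i 0, v i 1, v i 2])).submatrix σ id
    = Matrix.of (fun i => ![1, (v ∘ σ) i 0, (v ∘ σ) i 1, (v ∘ σ) i 2]) := by
    ext i j; simp
  rw [h2] at this
  rw [this, abs_mul]
  rcases Int.units_eq_one_or (Equiv.Perm.sign σ) with h | h <;> simp [h]

/-- the tetrahedron -/
def Tet (v : Fin 4 → Fin 3 → ℤ) : Set (Fin 3 → ℝ) := convexHull ℝ (Set.range (fun i => toR3 (v i)))

lemma Tet_perm (v : Fin 4 → Fin 3 → ℤ) (σ : Equiv.Perm (Fin 4)) : Tet (v ∘ σ) = Tet v := by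
  unfold Tet
  congr 1
  exact σ.surjective.range_comp (fun i => toR3 (v i))

lemma toR3_update (v : Fin 4 → Fin 3 → ℤ) (i : Fin 4) (m : Fin 3 → ℤ) :
    (fun j => toR3 (Function.update v i m j)) = Function.update (fun j => toR3 (v j)) i (toR3 m) := by
  ext j
  by_cases h : j = i
  · subst h; simp
  · simp [h]

lemma bary (v : Fin 4 → Fin 3 → ℤ) (m : Fin 3 → ℤ) (hD : Dv v ≠ 0) :
    ∑ i, (Dv (Function.update v i m) : ℝ) / Dv v = 1 ∧
    ∑ i, ((Dv (Function.update v i m) : ℝ) / Dv v) • toR3 (v i) = toR3 m := by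
  have hR : (Dv v : ℝ) ≠ 0 := by exact_mod_cast hD
  constructor
  · rw [← Finset.sum_div]
    rw [div_eq_one_iff_eq hR]
    exact_mod_cast Dv_sum v m
  · ext k
    simp only [Finset.sum_apply, Pi.smul_apply, smul_eq_mul, toR3]
    have : ∑ i, (Dv (Function.update v i m) : ℝ) * v i k = Dv v * m k := by
      exact_mod_cast Dv_comb v m k
    simp only [div_mul_eq_mul_div]
    rw [← Finset.sum_div, this]
    field_simp

lemma tet_pivot_in (v : Fin 4 → Fin 3 → ℤ) (m : Fin 3 → ℤ) (hD : Dv v ≠ 0) (x : Fin 3 → ℝ)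
    (hx : x ∈ Tet v) :
    ∃ i, Dv (Function.update v i m) ≠ 0 ∧ x ∈ Tet (Function.update v i m) := by
  obtain ⟨h1, h2⟩ := bary v m hD
  obtain ⟨i, hi, hxi⟩ := pivot_in _ _ x hx _ h1 h2
  refine ⟨i, ?_, ?_⟩
  · intro h; rw [h] at hi; simp at hi
  · unfold Tet; rw [toR3_update]; exact hxi

lemma tet_pivot_out (v : Fin 4 → Fin 3 → ℤ) (m : Fin 3 → ℤ) (hD : Dv v ≠ 0) (x y : Fin 3 → ℝ)
    (hy : y ∈ Tet v) (hx : x ∈ segment ℝ (toR3 m) y) :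
    x ∈ Tet v ∨ ∃ i, Dv (Function.update v i m) ≠ 0 ∧ x ∈ Tet (Function.update v i m) := by
  obtain ⟨h1, h2⟩ := bary v m hD
  rcases pivot_out _ _ y x hy hx _ h1 h2 with h | ⟨i, hi, hxi⟩
  · exact Or.inl h
  · refine Or.inr ⟨i, ?_, ?_⟩
    · intro h; rw [h] at hi; simp at hi
    · unfold Tet; rw [toR3_update]; exact hxi

lemma start (W : Set (Fin 3 → ℤ)) (hW : W.Finite) (v0 : Fin 4 → Fin 3 → ℤ) (hv0 : ∀ i, v0 i ∈ W)
    (hD0 : Dv v0 ≠ 0) (x : Fin 3 → ℝ) (hx : x ∈ convexHull ℝ (toR3 '' W)) :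
    ∃ v : Fin 4 → Fin 3 → ℤ, (∀ i, v i ∈ W) ∧ Dv v ≠ 0 ∧ x ∈ Tet v := by
  have main : ∀ F : Set (Fin 3 → ℤ), F.Finite → F ⊆ W → ∀ x,
      x ∈ convexHull ℝ (toR3 '' F ∪ Set.range (fun i => toR3 (v0 i))) →
      ∃ v : Fin 4 → Fin 3 → ℤ, (∀ i, v i ∈ W) ∧ Dv v ≠ 0 ∧ x ∈ Tet v := by
    intro F hF
    induction F, hF using Set.Finite.induction_on with
    | empty =>
      intro _ x hx
      refine ⟨v0, hv0, hD0, ?_⟩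
      simpa [Tet] using hx
    | @insert m S _ _ ih =>
      intro hS x hx
      rw [Set.image_insert_eq, Set.insert_union, convexHull_insert
        ((Set.range_nonempty _).mono Set.subset_union_right)] at hx
      simp only [convexJoin_singleton_left, Set.mem_iUnion] at hx
      obtain ⟨y, hy, hxy⟩ := hx
      obtain ⟨v, hvW, hD, hyv⟩ := ih (fun a ha => hS (Set.mem_insert_of_mem _ ha)) y hy
      rcases tet_pivot_out v m hD x y hyv hxy with h | ⟨i, hi, hxi⟩
      · exact ⟨v, hvW, hD, h⟩
      · refine ⟨_, ?_, hi, hxi⟩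
        intro j
        by_cases h : j = i
        · subst h; simpa using hS (Set.mem_insert _ _)
        · simpa [h] using hvW j
  exact main W hW subset_rfl x (convexHull_mono Set.subset_union_left hx)


def cr (a b c : ℤ × ℤ) : ℤ := (b.1 - a.1) * (c.2 - a.2) - (b.2 - a.2) * (c.1 - a.1)

lemma tri_aux (a b c : ℤ × ℤ) (h : 2 ≤ |cr a b c|) :
    ∃ e : ℤ × ℤ, ¬ (cr a b c ∣ e.1 * (c.2 - a.2) - e.2 * (c.1 - a.1) ∧
      cr a b c ∣ (b.1 - a.1) * e.2 - (b.2 - a.2) * e.1) := by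
  by_contra hcon
  push Not at hcon
  obtain ⟨⟨p, hp⟩, ⟨q, hq⟩⟩ := hcon (1, 0)
  obtain ⟨⟨r, hr⟩, ⟨s, hs⟩⟩ := hcon (0, 1)
  set d := cr a b c with hd
  have hd' : d = (b.1 - a.1) * (c.2 - a.2) - (b.2 - a.2) * (c.1 - a.1) := rfl
  simp only [one_mul, zero_mul, sub_zero, mul_zero, mul_one, zero_sub] at hp hq hr hs
  have h1 : d * 1 = d * (d * (s * p - q * r)) := by
    have e1 : b.2 - a.2 = - (d * q) := by linarith
    have e2 : c.1 - a.1 = - (d * r) := by linarith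
    rw [hp, hs, e1, e2] at hd'
    linear_combination hd'
  have hd0 : d ≠ 0 := by
    intro h0; rw [h0] at h; simp at h
  have h2 := mul_left_cancel₀ hd0 h1
  have : |d| ∣ 1 := (abs_dvd _ _).2 ⟨_, h2⟩
  have := Int.le_of_dvd one_pos this
  omega

lemma tri_fin (S : Set (ℝ × ℝ)) (hS : Convex ℝ S) (a b c : ℤ × ℤ) (ha : a ∈ ZP S) (hb : b ∈ ZP S)
    (hc : c ∈ ZP S) (hd : cr a b c ≠ 0) (s t : ℝ) (hs : 0 ≤ s) (ht : 0 ≤ t) (hst : s + t ≤ 1)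
    (hs1 : s < 1) (ht1 : t < 1) (h0 : 0 < s + t) (m : ℤ × ℤ)
    (h1 : (m.1 : ℝ) = a.1 + s * (b.1 - a.1) + t * (c.1 - a.1))
    (h2 : (m.2 : ℝ) = a.2 + s * (b.2 - a.2) + t * (c.2 - a.2)) :
    m ∈ ZP S ∧ |cr m b c| < |cr a b c| ∧ |cr a m c| < |cr a b c| ∧ |cr a b m| < |cr a b c| := by
  have hpos : (0:ℝ) < |(cr a b c : ℝ)| := abs_pos.2 (by exact_mod_cast hd)
  have hl : ∀ (n : ℤ) (r : ℝ), 0 ≤ r → r < 1 → (n : ℝ) = r * (cr a b c : ℝ) →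
      |n| < |cr a b c| := by
    intro n r hr hr1 h
    have : |(n:ℝ)| < |(cr a b c : ℝ)| := by
      rw [h, abs_mul, abs_of_nonneg hr]
      nlinarith
    exact_mod_cast this
  refine ⟨?_, hl _ (1 - s - t) (by linarith) (by linarith) ?_, hl _ s hs hs1 ?_, hl _ t ht ht1 ?_⟩
  · have hcA : convexHull ℝ (Set.range ![((a.1:ℝ), (a.2:ℝ)), ((b.1:ℝ), (b.2:ℝ)), ((c.1:ℝ), (c.2:ℝ))])
      ⊆ S := by
      apply convexHull_min _ hS
      rintro _ ⟨i, rfl⟩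
      fin_cases i
      · exact ha
      · exact hb
      · exact hc
    apply hcA
    rw [mem_hull_range]
    refine ⟨![1 - s - t, s, t], ?_, ?_, ?_⟩
    · intro i; fin_cases i
      · show 0 ≤ 1 - s - t
        linarith
      · exact hs
      · exact ht
    · simp [Fin.sum_univ_three]; ring
    · simp [Fin.sum_univ_three]
      constructor <;> linarith
  · simp only [cr]; push_cast; rw [h1, h2]; ring
  · simp only [cr]; push_cast; rw [h1, h2]; ring
  · simp only [cr]; push_cast; rw [h1, h2]; ring

lemma tri (S : Set (ℝ × ℝ)) (hS : Convex ℝ S) (a b c : ℤ × ℤ) (ha : a ∈ ZP S) (hb : b ∈ ZP S)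
    (hc : c ∈ ZP S) (h : 2 ≤ |cr a b c|) :
    ∃ m ∈ ZP S, |cr m b c| < |cr a b c| ∧ |cr a m c| < |cr a b c| ∧ |cr a b m| < |cr a b c| := by
  obtain ⟨e, he⟩ := tri_aux a b c h
  have hd0 : cr a b c ≠ 0 := by
    intro h0; rw [h0] at h; simp at h
  set d := cr a b c with hd
  have hdR : (d:ℝ) ≠ 0 := by exact_mod_cast hd0
  set X := e.1 * (c.2 - a.2) - e.2 * (c.1 - a.1) with hX
  set Y := (b.1 - a.1) * e.2 - (b.2 - a.2) * e.1 with hY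
  set s : ℝ := (X:ℝ) / d with hs
  set t : ℝ := (Y:ℝ) / d with ht
  have e1 : (e.1:ℝ) = s * (b.1 - a.1) + t * (c.1 - a.1) := by
    rw [hs, ht]; field_simp
    rw [hX, hY, hd]; simp only [cr]; push_cast; ring
  have e2 : (e.2:ℝ) = s * (b.2 - a.2) + t * (c.2 - a.2) := by
    rw [hs, ht]; field_simp
    rw [hX, hY, hd]; simp only [cr]; push_cast; ring
  have hf : 0 < Int.fract s + Int.fract t := by
    by_contra hn
    have h1 := Int.fract_nonneg s
    have h2 := Int.fract_nonneg t
    have h3 : Int.fract s = 0 := by linarith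
    have h4 : Int.fract t = 0 := by linarith
    apply he
    have h5 : s = ⌊s⌋ := by have := Int.self_sub_floor s; linarith
    have h6 : t = ⌊t⌋ := by have := Int.self_sub_floor t; linarith
    refine ⟨⟨⌊s⌋, ?_⟩, ⟨⌊t⌋, ?_⟩⟩
    · have : (X:ℝ) = d * ⌊s⌋ := by rw [← h5, hs]; field_simp
      exact_mod_cast this
    · have : (Y:ℝ) = d * ⌊t⌋ := by rw [← h6, ht]; field_simp
      exact_mod_cast this
  have s0 := Int.fract_nonneg s
  have s1 := Int.fract_lt_one s
  have t0 := Int.fract_nonneg t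
  have t1 := Int.fract_lt_one t
  have sf : Int.fract s = s - ⌊s⌋ := (Int.self_sub_floor s).symm
  have tf : Int.fract t = t - ⌊t⌋ := (Int.self_sub_floor t).symm
  rcases le_or_gt (Int.fract s + Int.fract t) 1 with hle | hgt
  · refine ⟨(a.1 + e.1 - ⌊s⌋ * (b.1 - a.1) - ⌊t⌋ * (c.1 - a.1),
      a.2 + e.2 - ⌊s⌋ * (b.2 - a.2) - ⌊t⌋ * (c.2 - a.2)), ?_⟩
    apply tri_fin S hS a b c ha hb hc hd0 _ _ s0 t0 hle s1 t1 hf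
    · push_cast; rw [e1, sf, tf]; ring
    · push_cast; rw [e2, sf, tf]; ring
  · refine ⟨(a.1 - e.1 + (⌊s⌋ + 1) * (b.1 - a.1) + (⌊t⌋ + 1) * (c.1 - a.1),
      a.2 - e.2 + (⌊s⌋ + 1) * (b.2 - a.2) + (⌊t⌋ + 1) * (c.2 - a.2)), ?_⟩
    apply tri_fin S hS a b c ha hb hc hd0 (1 - Int.fract s) (1 - Int.fract t) (by linarith)
      (by linarith) (by linarith) (by linarith) (by linarith) (by linarith)
    · push_cast; rw [e1, sf, tf]; ring
    · push_cast; rw [e2, sf, tf]; ring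

def WL (j : ℤ) (A B : Set (ℝ × ℝ)) : Set (Fin 3 → ℤ) :=
  {p | (p 2 = j ∧ (p 0, p 1) ∈ ZP A) ∨ (p 2 = j + 1 ∧ (p 0, p 1) ∈ ZP B)}

def Key (A B : Set (ℝ × ℝ)) : Prop :=
  ∀ a ∈ ZP A, ∀ a' ∈ ZP A, ∀ b ∈ ZP B, ∀ b' ∈ ZP B, ∀ d : ℤ,
    d = (a'.1 - a.1) * (b'.2 - b.2) - (a'.2 - a.2) * (b'.1 - b.1) → 2 ≤ d →
    (∃ q ∈ ZP B, 0 < (a'.1 - a.1) * (q.2 - b.2) - (a'.2 - a.2) * (q.1 - b.1) ∧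
      (a'.1 - a.1) * (q.2 - b.2) - (a'.2 - a.2) * (q.1 - b.1) < d) ∨
    (∃ p ∈ ZP A, 0 < (p.1 - a.1) * (b'.2 - b.2) - (p.2 - a.2) * (b'.1 - b.1) ∧
      (p.1 - a.1) * (b'.2 - b.2) - (p.2 - a.2) * (b'.1 - b.1) < d)

lemma WL_slice (j : ℤ) (A B : Set (ℝ × ℝ)) (hA : Convex ℝ A) (hB : Convex ℝ B) (w : Fin 3 → ℤ)
    (hw : w ∈ WL j A B) : ∃ S : Set (ℝ × ℝ), Convex ℝ S ∧
      ∀ p : Fin 3 → ℤ, p 2 = w 2 → (p ∈ WL j A B ↔ (p 0, p 1) ∈ ZP S) := by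
  rcases hw with ⟨h, _⟩ | ⟨h, _⟩
  · refine ⟨A, hA, fun p hp => ?_⟩
    rw [h] at hp
    simp [WL, hp]
  · refine ⟨B, hB, fun p hp => ?_⟩
    rw [h] at hp
    simp [WL, hp]

lemma layer31 (j : ℤ) (A B : Set (ℝ × ℝ)) (hA : Convex ℝ A) (hB : Convex ℝ B) (x : Fin 3 → ℝ) :
    ∀ (n : ℕ) (v : Fin 4 → Fin 3 → ℤ), (Dv v).natAbs ≤ n → (∀ i, v i ∈ WL j A B) →
    (∃ i h, ∀ l, l ≠ i → v l 2 = h) → Dv v ≠ 0 → x ∈ Tet v →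
    ∃ v' : Fin 4 → Fin 3 → ℤ, (∀ i, v' i ∈ WL j A B) ∧ |Dv v'| = 1 ∧ x ∈ Tet v' := by
  intro n
  induction n with
  | zero => intro v h _ _ hD _; omega
  | succ n ih =>
    intro v hn hW ⟨i, h, hi⟩ hD hx
    by_cases h1 : |Dv v| = 1
    · exact ⟨v, hW, h1, hx⟩
    -- permute
    set σ : Equiv.Perm (Fin 4) := Equiv.swap i 3 with hσ
    set u := v ∘ σ with hu
    have huW : ∀ i, u i ∈ WL j A B := fun i => hW _
    have huD : |Dv u| = |Dv v| := Dv_perm v σ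
    have hux : x ∈ Tet u := by rw [hu, Tet_perm]; exact hx
    have huh : ∀ l, l ≠ 3 → u l 2 = h := by
      intro l hl
      apply hi
      intro h'
      apply hl
      have : σ (σ l) = σ i := by rw [h']
      simpa [hσ] using this
    have h0 := huh 0 (by decide)
    have h1' := huh 1 (by decide)
    have h2 := huh 2 (by decide)
    have hDu : Dv u = cr (u 0 0, u 0 1) (u 1 0, u 1 1) (u 2 0, u 2 1) * (u 3 2 - h) := by
      rw [Dv_eq, h0, h1', h2]; simp only [cr]; ring
    have hDu0 : Dv u ≠ 0 := by
      intro h'; rw [h'] at huD; simp at huD; exact hD (abs_eq_zero.1 huD.symm)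
    have hh3 : |u 3 2 - h| = 1 := by
      have e3 := huW 3
      have e0 := huW 0
      have hne : u 3 2 - h ≠ 0 := by
        intro h'; rw [h', mul_zero] at hDu; exact hDu0 hDu
      simp only [WL, Set.mem_ofPred_eq] at e3 e0
      rw [h0] at e0
      rcases abs_cases (u 3 2 - h) with ⟨e, _⟩ | ⟨e, _⟩ <;> rw [e] <;> omega
    have habs : |Dv u| = |cr (u 0 0, u 0 1) (u 1 0, u 1 1) (u 2 0, u 2 1)| := by
      rw [hDu, abs_mul, hh3, mul_one]
    have hge : 2 ≤ |cr (u 0 0, u 0 1) (u 1 0, u 1 1) (u 2 0, u 2 1)| := by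
      rw [← habs, huD]
      have := abs_pos.2 hD
      omega
    obtain ⟨S, hS, hSW⟩ := WL_slice j A B hA hB (u 0) (huW 0)
    rw [h0] at hSW
    obtain ⟨m, hm, m0, m1, m2⟩ := tri S hS _ _ _ ((hSW _ h0).1 (huW 0)) ((hSW _ h1').1 (huW 1))
      ((hSW _ h2).1 (huW 2)) hge
    set mm : Fin 3 → ℤ := ![m.1, m.2, h] with hmm
    have hmW : mm ∈ WL j A B := (hSW mm rfl).2 (by simpa [hmm] using hm)
    obtain ⟨r, hr, hxr⟩ := tet_pivot_in u mm hDu0 x hux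
    have hbound : |Dv (Function.update u r mm)| < |Dv u| ∧ r ≠ 3 := by
      have g0 : Dv (Function.update u 0 mm) = cr m (u 1 0, u 1 1) (u 2 0, u 2 1) * (u 3 2 - h) := by
        rw [Dv_eq]; simp [Function.update, h1', h2, cr, hmm]; ring
      have g1 : Dv (Function.update u 1 mm) = cr (u 0 0, u 0 1) m (u 2 0, u 2 1) * (u 3 2 - h) := by
        rw [Dv_eq]; simp [Function.update, h0, h2, cr, hmm]; ring
      have g2 : Dv (Function.update u 2 mm) = cr (u 0 0, u 0 1) (u 1 0, u 1 1) m * (u 3 2 - h) := by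
        rw [Dv_eq]; simp [Function.update, h0, h1', cr, hmm]; ring
      have g3 : Dv (Function.update u 3 mm) = 0 := by
        rw [Dv_eq]; simp [Function.update, h0, h1', h2, hmm]
      have : r = 0 ∨ r = 1 ∨ r = 2 ∨ r = 3 := by
        fin_cases r <;> simp
      rcases this with rfl | rfl | rfl | rfl
      · refine ⟨?_, by decide⟩
        rw [habs, g0, abs_mul, hh3, mul_one]; exact m0
      · refine ⟨?_, by decide⟩
        rw [habs, g1, abs_mul, hh3, mul_one]; exact m1
      · refine ⟨?_, by decide⟩
        rw [habs, g2, abs_mul, hh3, mul_one]; exact m2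
      · exact absurd g3 hr
    refine ih (Function.update u r mm) ?_ ?_ ⟨3, h, ?_⟩ hr hxr
    · have := hbound.1
      rw [huD, Int.abs_eq_natAbs, Int.abs_eq_natAbs] at this
      omega
    · intro l
      by_cases hl : l = r
      · subst hl; simpa using hmW
      · simpa [hl] using huW l
    · intro l hl3
      by_cases hl : l = r
      · subst hl; simp [hmm]
      · simpa [hl] using huh l hl3

lemma perm_cases : ∀ f : Fin 4 → Bool, (∃ i c, ∀ l, l ≠ i → f l = c) ∨
    ∃ σ : Equiv.Perm (Fin 4), f (σ 0) = false ∧ f (σ 1) = false ∧ f (σ 2) = true ∧ f (σ 3) = true := by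
  decide +kernel

lemma upd_mem {W : Set (Fin 3 → ℤ)} {u : Fin 4 → Fin 3 → ℤ} (hu : ∀ i, u i ∈ W) (r : Fin 4)
    {m : Fin 3 → ℤ} (hm : m ∈ W) : ∀ i, Function.update u r m i ∈ W := by
  intro l
  by_cases hl : l = r
  · subst hl; simpa using hm
  · simpa [hl] using hu l

lemma layer22 (j : ℤ) (A B : Set (ℝ × ℝ)) (hA : Convex ℝ A) (hB : Convex ℝ B) (hK : Key A B)
    (x : Fin 3 → ℝ) :
    ∀ (n : ℕ) (v : Fin 4 → Fin 3 → ℤ), (Dv v).natAbs ≤ n → (∀ i, v i ∈ WL j A B) →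
    Dv v ≠ 0 → x ∈ Tet v →
    ∃ v' : Fin 4 → Fin 3 → ℤ, (∀ i, v' i ∈ WL j A B) ∧ |Dv v'| = 1 ∧ x ∈ Tet v' := by
  intro n
  induction n with
  | zero => intro v h _ hD _; omega
  | succ n ih =>
    intro v hn hW hD hx
    by_cases h1 : |Dv v| = 1
    · exact ⟨v, hW, h1, hx⟩
    by_cases h31 : ∃ i h, ∀ l, l ≠ i → v l 2 = h
    · exact layer31 j A B hA hB x _ v le_rfl hW h31 hD hx
    have hht : ∀ i, v i 2 = j ∨ v i 2 = j + 1 := by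
      intro i
      rcases hW i with h | h
      · exact Or.inl h.1
      · exact Or.inr h.1
    -- sort
    obtain ⟨u, huW, huD, hux, k0, k1, k2, k3⟩ : ∃ u : Fin 4 → Fin 3 → ℤ, (∀ i, u i ∈ WL j A B) ∧
        |Dv u| = |Dv v| ∧ x ∈ Tet u ∧ u 0 2 = j ∧ u 1 2 = j ∧ u 2 2 = j + 1 ∧ u 3 2 = j + 1 := by
      rcases perm_cases (fun i => decide (v i 2 = j + 1)) with ⟨i, c, hc⟩ | ⟨σ, s0, s1, s2, s3⟩
      · exfalso
        apply h31
        refine ⟨i, if c then j + 1 else j, fun l hl => ?_⟩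
        have := hc l hl
        rcases hht l with h | h <;> simp [h] at this <;> simp [← this, h]
      · simp only [decide_eq_false_iff_not, decide_eq_true_eq] at s0 s1 s2 s3
        refine ⟨v ∘ σ, fun i => hW _, Dv_perm v σ, by rw [Tet_perm]; exact hx, ?_, ?_, s2, s3⟩
        · exact (hht _).resolve_right s0
        · exact (hht _).resolve_right s1
    have huD0 : Dv u ≠ 0 := by
      intro h'; rw [h'] at huD; simp at huD; exact hD (abs_eq_zero.1 huD.symm)
    -- orient
    obtain ⟨w, hwW, hwD, hwx, l0, l1, l2, l3⟩ : ∃ w : Fin 4 → Fin 3 → ℤ, (∀ i, w i ∈ WL j A B) ∧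
        (-Dv w) = |Dv v| ∧ x ∈ Tet w ∧ w 0 2 = j ∧ w 1 2 = j ∧ w 2 2 = j + 1 ∧ w 3 2 = j + 1 := by
      rcases le_or_gt (Dv u) 0 with h | h
      · exact ⟨u, huW, by rw [← huD, abs_of_nonpos h], hux, k0, k1, k2, k3⟩
      · refine ⟨u ∘ Equiv.swap 2 3, fun i => huW _, ?_, by rw [Tet_perm]; exact hux, k0, k1, ?_, ?_⟩
        · rw [← huD, abs_of_pos h, Dv_eq, Dv_eq]
          simp [Equiv.swap_apply_def]; ring
        · simpa using k3
        · simpa using k2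
    have hwD0 : Dv w ≠ 0 := by
      intro h'; rw [h'] at hwD; simp at hwD; exact hD (abs_eq_zero.1 hwD.symm)
    have ha : ∀ p : Fin 3 → ℤ, p 2 = j → (p ∈ WL j A B ↔ (p 0, p 1) ∈ ZP A) := by
      intro p hp; simp [WL, hp]
    have hb : ∀ p : Fin 3 → ℤ, p 2 = j + 1 → (p ∈ WL j A B ↔ (p 0, p 1) ∈ ZP B) := by
      intro p hp; simp [WL, hp]
    have hd2 : 2 ≤ -Dv w := by
      rw [hwD]
      have := abs_pos.2 hD
      omega
    have hfin : ∀ (r : Fin 4) (mm : Fin 3 → ℤ), mm ∈ WL j A B → Dv (Function.update w r mm) ≠ 0 →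
        x ∈ Tet (Function.update w r mm) → ((∃ i h, ∀ l, l ≠ i → Function.update w r mm l 2 = h) ∨
          |Dv (Function.update w r mm)| < -Dv w) →
        ∃ v' : Fin 4 → Fin 3 → ℤ, (∀ i, v' i ∈ WL j A B) ∧ |Dv v'| = 1 ∧ x ∈ Tet v' := by
      intro r mm hmm hr hxr hcase
      rcases hcase with hc | hc
      · exact layer31 j A B hA hB x _ _ le_rfl (upd_mem hwW r hmm) hc hr hxr
      · refine ih _ ?_ (upd_mem hwW r hmm) hr hxr
        rw [hwD, Int.abs_eq_natAbs, Int.abs_eq_natAbs] at hc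
        omega
    have hr4 : ∀ r : Fin 4, r = 0 ∨ r = 1 ∨ r = 2 ∨ r = 3 := by
      intro r; fin_cases r <;> simp
    rcases hK _ ((ha _ l0).1 (hwW 0)) _ ((ha _ l1).1 (hwW 1)) _ ((hb _ l2).1 (hwW 2)) _
      ((hb _ l3).1 (hwW 3)) (-Dv w) (by rw [Dv_eq, l0, l1, l2, l3]; ring) hd2 with
      ⟨q, hq, q0, q1⟩ | ⟨q, hq, q0, q1⟩
    · set mm : Fin 3 → ℤ := ![q.1, q.2, j + 1] with hmm
      have hmW : mm ∈ WL j A B := (hb mm rfl).2 (by simpa [hmm] using hq)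
      obtain ⟨r, hr, hxr⟩ := tet_pivot_in w mm hwD0 x hwx
      refine hfin r mm hmW hr hxr ?_
      rcases hr4 r with rfl | rfl | rfl | rfl
      · left
        refine ⟨1, j + 1, fun l hl => ?_⟩
        rcases hr4 l with rfl | rfl | rfl | rfl <;> first
          | exact absurd rfl hl
          | simp [Function.update, l0, l1, l2, l3, hmm]
      · left
        refine ⟨0, j + 1, fun l hl => ?_⟩
        rcases hr4 l with rfl | rfl | rfl | rfl <;> first
          | exact absurd rfl hl
          | simp [Function.update, l0, l1, l2, l3, hmm]
      · right
        have g : Dv (Function.update w 2 mm) = Dv w + ((w 1 0 - w 0 0) * (q.2 - w 2 1) - (w 1 1 - w 0 1) * (q.1 - w 2 0)) := by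
          rw [Dv_eq, Dv_eq]; simp [Function.update, l0, l1, l2, l3, hmm]; ring
        rw [g, abs_lt]
        simp only at q0 q1
        constructor <;> linarith
      · right
        have g : Dv (Function.update w 3 mm) = - ((w 1 0 - w 0 0) * (q.2 - w 2 1) - (w 1 1 - w 0 1) * (q.1 - w 2 0)) := by
          rw [Dv_eq]; simp [Function.update, l0, l1, l2, hmm]; ring
        rw [g, abs_lt]
        simp only at q0 q1
        constructor <;> linarith
    · set mm : Fin 3 → ℤ := ![q.1, q.2, j] with hmm
      have hmW : mm ∈ WL j A B := (ha mm rfl).2 (by simpa [hmm] using hq)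
      obtain ⟨r, hr, hxr⟩ := tet_pivot_in w mm hwD0 x hwx
      refine hfin r mm hmW hr hxr ?_
      rcases hr4 r with rfl | rfl | rfl | rfl
      · right
        have g : Dv (Function.update w 0 mm) = Dv w + ((q.1 - w 0 0) * (w 3 1 - w 2 1) - (q.2 - w 0 1) * (w 3 0 - w 2 0)) := by
          rw [Dv_eq, Dv_eq]; simp [Function.update, l0, l1, l2, l3, hmm]; ring
        rw [g, abs_lt]
        simp only at q0 q1
        constructor <;> linarith
      · right
        have g : Dv (Function.update w 1 mm) = - ((q.1 - w 0 0) * (w 3 1 - w 2 1) - (q.2 - w 0 1) * (w 3 0 - w 2 0)) := by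
          rw [Dv_eq]; simp [Function.update, l0, l2, l3, hmm]; ring
        rw [g, abs_lt]
        simp only at q0 q1
        constructor <;> linarith
      · left
        refine ⟨3, j, fun l hl => ?_⟩
        rcases hr4 l with rfl | rfl | rfl | rfl <;> first
          | exact absurd rfl hl
          | simp [Function.update, l0, l1, l2, l3, hmm]
      · left
        refine ⟨2, j, fun l hl => ?_⟩
        rcases hr4 l with rfl | rfl | rfl | rfl <;> first
          | exact absurd rfl hl
          | simp [Function.update, l0, l1, l2, l3, hmm]

/-- A layer is covered by unimodular tetrahedra. -/
lemma layer_cover (j : ℤ) (A B : Set (ℝ × ℝ)) (hA : Convex ℝ A) (hB : Convex ℝ B) (hK : Key A B)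
    (hfin : (WL j A B).Finite) (v0 : Fin 4 → Fin 3 → ℤ) (hv0 : ∀ i, v0 i ∈ WL j A B)
    (hD0 : Dv v0 ≠ 0) (x : Fin 3 → ℝ) (hx : x ∈ convexHull ℝ (toR3 '' WL j A B)) :
    ∃ v' : Fin 4 → Fin 3 → ℤ, (∀ i, v' i ∈ WL j A B) ∧ |Dv v'| = 1 ∧ x ∈ Tet v' := by
  obtain ⟨v, hv, hD, hxv⟩ := start _ hfin v0 hv0 hD0 x hx
  exact layer22 j A B hA hB hK x _ v le_rfl hv hD hxv

open scoped Pointwise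

def emb (p : ℤ × ℤ) : ℝ × ℝ := ((p.1 : ℝ), (p.2 : ℝ))

def LH (S : Set (ℝ × ℝ)) : Prop := S ⊆ convexHull ℝ (emb '' ZP S)

def Sl (Q R : Set (ℝ × ℝ)) (s : ℝ) : Set (ℝ × ℝ) :=
  {y | ∃ a ∈ Q, ∃ b ∈ R, y = (1 - s) • a + s • b}

lemma Key_of_Ref2 {A B : Set (ℝ × ℝ)} (hA : Convex ℝ A) (hB : Convex ℝ B)
    (fA : (ZP A).Finite) (fB : (ZP B).Finite) (h : Ref2 A B) : Key A B := by
  intro a ha a' ha' b hb b' hb' d hd h2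
  exact key2d A B hA hB fA fB h a a' b b' ha ha' hb hb' d hd h2

lemma Key_of_Ref2' {A B : Set (ℝ × ℝ)} (hA : Convex ℝ A) (hB : Convex ℝ B)
    (fA : (ZP A).Finite) (fB : (ZP B).Finite) (h : Ref2 B A) : Key A B := by
  intro a ha a' ha' b hb b' hb' d hd h2
  rcases key2d B A hB hA fB fA h b' b a a' hb' hb ha ha' d (by rw [hd]; ring) h2 with
    ⟨q, hq, h1, h3⟩ | ⟨q, hq, h1, h3⟩
  · right
    refine ⟨q, hq, ?_, ?_⟩ <;> linarith
  · left
    refine ⟨q, hq, ?_, ?_⟩ <;> linarith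

lemma Sl_convex {Q R : Set (ℝ × ℝ)} (hQ : Convex ℝ Q) (hR : Convex ℝ R) (s : ℝ) :
    Convex ℝ (Sl Q R s) := by
  have : Sl Q R s = (1 - s) • Q + s • R := by
    ext y
    simp only [Sl, Set.mem_add, Set.mem_smul_set, Set.mem_ofPred_eq]
    constructor
    · rintro ⟨a, ha, b, hb, rfl⟩
      exact ⟨_, ⟨a, ha, rfl⟩, _, ⟨b, hb, rfl⟩, rfl⟩
    · rintro ⟨_, ⟨a, ha, rfl⟩, _, ⟨b, hb, rfl⟩, rfl⟩
      exact ⟨a, ha, b, hb, rfl⟩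
  rw [this]
  exact (hQ.smul _).add (hR.smul _)

lemma Sl_compact {Q R : Set (ℝ × ℝ)} (hQ : IsCompact Q) (hR : IsCompact R) (s : ℝ) :
    IsCompact (Sl Q R s) := by
  have : Sl Q R s = (1 - s) • Q + s • R := by
    ext y
    simp only [Sl, Set.mem_add, Set.mem_smul_set, Set.mem_ofPred_eq]
    constructor
    · rintro ⟨a, ha, b, hb, rfl⟩
      exact ⟨_, ⟨a, ha, rfl⟩, _, ⟨b, hb, rfl⟩, rfl⟩
    · rintro ⟨_, ⟨a, ha, rfl⟩, _, ⟨b, hb, rfl⟩, rfl⟩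
      exact ⟨a, ha, b, hb, rfl⟩
  rw [this]
  exact (hQ.smul _).add (hR.smul _)

lemma ZP_finite {S : Set (ℝ × ℝ)} (hS : IsCompact S) : (ZP S).Finite := by
  obtain ⟨C, hC⟩ := hS.isBounded.exists_norm_le
  apply Set.Finite.subset (Set.finite_Icc ((-⌈C⌉, -⌈C⌉) : ℤ × ℤ) (⌈C⌉, ⌈C⌉))
  intro p hp
  have h := hC _ hp
  rw [Prod.norm_def, max_le_iff, Real.norm_eq_abs, Real.norm_eq_abs, abs_le, abs_le] at h
  obtain ⟨⟨h1, h2⟩, h3, h4⟩ := h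
  have hc := Int.le_ceil C
  simp only at h1 h2 h3 h4
  rw [Set.mem_Icc, Prod.le_def, Prod.le_def]
  refine ⟨⟨?_, ?_⟩, ?_, ?_⟩
  · show -⌈C⌉ ≤ p.1
    have : ((-⌈C⌉ : ℤ) : ℝ) ≤ p.1 := by push_cast; linarith
    exact_mod_cast this
  · show -⌈C⌉ ≤ p.2
    have : ((-⌈C⌉ : ℤ) : ℝ) ≤ p.2 := by push_cast; linarith
    exact_mod_cast this
  · show p.1 ≤ ⌈C⌉
    have : (p.1 : ℝ) ≤ ⌈C⌉ := by linarith
    exact_mod_cast this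
  · show p.2 ≤ ⌈C⌉
    have : (p.2 : ℝ) ≤ ⌈C⌉ := by linarith
    exact_mod_cast this

lemma hull_ZP_sub {S : Set (ℝ × ℝ)} (hS : Convex ℝ S) : convexHull ℝ (emb '' ZP S) ⊆ S := by
  apply convexHull_min _ hS
  rintro _ ⟨p, hp, rfl⟩
  exact hp

lemma ext_lattice {S : Set (ℝ × ℝ)} (hS : Convex ℝ S) (hL : LH S) {p : ℝ × ℝ}
    (hp : p ∈ S.extremePoints ℝ) : ∃ z ∈ ZP S, emb z = p := by
  have e : S = convexHull ℝ (emb '' ZP S) := Set.Subset.antisymm hL (hull_ZP_sub hS)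
  have hp2 : p ∈ (convexHull ℝ (emb '' ZP S)).extremePoints ℝ := e ▸ hp
  have hp3 : p ∈ emb '' ZP S := extremePoints_convexHull_subset hp2
  exact hp3

lemma Sl_max_left {Q R : Set (ℝ × ℝ)} {s : ℝ} (hs : s < 1) (f : ℝ × ℝ →ₗ[ℝ] ℝ)
    {a b : ℝ × ℝ} (hb : b ∈ R)
    (h : ∀ y ∈ Sl Q R s, f y ≤ f ((1 - s) • a + s • b)) : ∀ c ∈ Q, f c ≤ f a := by
  intro c hc
  have := h _ ⟨c, hc, b, hb, rfl⟩
  simp only [map_add, map_smul, smul_eq_mul] at this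
  nlinarith

lemma Sl_max_right {Q R : Set (ℝ × ℝ)} {s : ℝ} (hs : 0 < s) (f : ℝ × ℝ →ₗ[ℝ] ℝ)
    {a b : ℝ × ℝ} (ha : a ∈ Q)
    (h : ∀ y ∈ Sl Q R s, f y ≤ f ((1 - s) • a + s • b)) : ∀ c ∈ R, f c ≤ f b := by
  intro c hc
  have := h _ ⟨a, ha, c, hc, rfl⟩
  simp only [map_add, map_smul, smul_eq_mul] at this
  nlinarith

lemma Sl_max {Q R : Set (ℝ × ℝ)} {s : ℝ} (hs : 0 ≤ s) (hs1 : s ≤ 1) (f : ℝ × ℝ →ₗ[ℝ] ℝ)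
    {a b : ℝ × ℝ} (ha : ∀ c ∈ Q, f c ≤ f a) (hb : ∀ c ∈ R, f c ≤ f b) :
    ∀ y ∈ Sl Q R s, f y ≤ f ((1 - s) • a + s • b) := by
  rintro _ ⟨c, hc, d, hd, rfl⟩
  have h1 := ha c hc
  have h2 := hb d hd
  simp only [map_add, map_smul, smul_eq_mul]
  have := mul_le_mul_of_nonneg_left h1 (sub_nonneg.2 hs1)
  have := mul_le_mul_of_nonneg_left h2 hs
  linarith

lemma LH_slices {Q R : Set (ℝ × ℝ)} (hQ : Convex ℝ Q) (hR : Convex ℝ R) (cQ : IsCompact Q)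
    (cR : IsCompact R) (nQ : Q.Nonempty) (nR : R.Nonempty) (hLQ : LH Q) (k : ℕ) (hk : 2 ≤ k)
    (h1 : LH (Sl Q R (1 / k))) (i : ℕ) (hi : i ≤ k) : LH (Sl Q R (i / k)) := by
  have hk0 : (0:ℝ) < k := by positivity
  have hk1 : (1:ℝ) / k < 1 := by
    rw [div_lt_one hk0]
    exact_mod_cast (by omega : 1 < k)
  have hi1 : (i:ℝ) / k ≤ 1 := by
    rw [div_le_one hk0]; exact_mod_cast hi
  intro x hx
  by_contra hxn
  have hfin : (ZP (Sl Q R (i / k))).Finite := ZP_finite (Sl_compact cQ cR _)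
  have hcl : IsClosed (convexHull ℝ (emb '' ZP (Sl Q R (i / k)))) :=
    (hfin.image emb).isClosed_convexHull ℝ
  obtain ⟨f, u, hf, hfx⟩ := geometric_hahn_banach_closed_point (convex_convexHull ℝ _) hcl hxn
  set S := Sl Q R (1 / k) with hS
  have cS : IsCompact S := Sl_compact cQ cR _
  have nS : S.Nonempty := by
    obtain ⟨a, ha⟩ := nQ
    obtain ⟨b, hb⟩ := nR
    exact ⟨_, a, ha, b, hb, rfl⟩
  have hexp : IsExposed ℝ S (f.toExposed S) := ContinuousLinearMap.toExposed.isExposed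
  have nF : (f.toExposed S).Nonempty := by
    obtain ⟨z, hz, hmax⟩ := cS.exists_isMaxOn nS f.continuous.continuousOn
    exact ⟨z, hz, hmax⟩
  obtain ⟨p, hp⟩ := (hexp.isCompact cS).extremePoints_nonempty nF
  have hpS : p ∈ S.extremePoints ℝ := hexp.isExtreme.extremePoints_subset_extremePoints hp
  have hpmax : ∀ y ∈ S, f y ≤ f p := (extremePoints_subset hp).2
  obtain ⟨z, hz, hzp⟩ := ext_lattice (Sl_convex hQ hR _) h1 hpS
  obtain ⟨a, ha, b, hb, hab⟩ := hpS.1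
  have haext : a ∈ Q.extremePoints ℝ := by
    refine ⟨ha, ?_⟩
    intro a1 ha1 a2 ha2 hseg
    obtain ⟨s, t, hs, ht, hst, rfl⟩ := hseg
    have hq := hpS.2 (x₁ := (1 - 1 / (k:ℝ)) • a1 + (1 / (k:ℝ)) • b)
      (x₂ := (1 - 1 / (k:ℝ)) • a2 + (1 / (k:ℝ)) • b) ⟨a1, ha1, b, hb, rfl⟩ ⟨a2, ha2, b, hb, rfl⟩
      ⟨s, t, hs, ht, hst, by
        rw [hab]
        have : t = 1 - s := by linarith
        subst this
        module⟩
    rw [hab] at hq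
    have hq := add_right_cancel hq
    exact smul_right_injective _ (sub_pos.2 hk1).ne' hq
  obtain ⟨za, hza, hzaa⟩ := ext_lattice hQ hLQ haext
  have hfa := Sl_max_left (Q := Q) (R := R) hk1 f.toLinearMap (a := a) hb (by
    intro y hy; have := hpmax y hy; rw [hab] at this; exact this)
  have hfb := Sl_max_right (Q := Q) (R := R) (s := 1 / (k:ℝ)) (by positivity) f.toLinearMap (b := b) ha (by
    intro y hy; have := hpmax y hy; rw [hab] at this; exact this)
  have hmax := Sl_max (by positivity) hi1 f.toLinearMap hfa hfb x hx
  have hlat : (1 - (i:ℝ) / k) • a + ((i:ℝ) / k) • b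
      = emb (za.1 + i * (z.1 - za.1), za.2 + i * (z.2 - za.2)) := by
    rw [← hzp, ← hzaa] at hab
    rw [← hzaa]
    have e1 := congrArg Prod.fst hab
    have e2 := congrArg Prod.snd hab
    simp [emb] at e1 e2
    ext
    · simp [emb]; rw [e1]; field_simp; ring
    · simp [emb]; rw [e2]; field_simp; ring
  have hmem : (za.1 + i * (z.1 - za.1), za.2 + i * (z.2 - za.2)) ∈ ZP (Sl Q R (i / k)) := by
    show emb (za.1 + i * (z.1 - za.1), za.2 + i * (z.2 - za.2)) ∈ Sl Q R (i / k)
    rw [← hlat]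
    exact ⟨a, ha, b, hb, rfl⟩
  have := hf _ (subset_convexHull ℝ _ ⟨_, hmem, rfl⟩)
  rw [← hlat] at this
  have h3 : f x ≤ f ((1 - (i:ℝ) / k) • a + ((i:ℝ) / k) • b) := hmax
  linarith

lemma two_max {S : Set (ℝ × ℝ)} (hL : LH S) (n : ℝ × ℝ →ₗ[ℝ] ℝ) (c1 c2 : ℝ × ℝ)
    (h1 : c1 ∈ S) (h2 : c2 ∈ S) (hne : c1 ≠ c2) (m1 : ∀ y ∈ S, n y ≤ n c1)
    (m2 : ∀ y ∈ S, n y ≤ n c2) :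
    ∃ y ∈ ZP S, ∃ y' ∈ ZP S, y ≠ y' ∧ n (emb y) = n c1 ∧ n (emb y') = n c1 := by
  by_contra hcon
  push Not at hcon
  obtain ⟨y0, hy0⟩ : ∃ y0 : ℝ × ℝ, ∀ y ∈ ZP S, n (emb y) = n c1 → emb y = y0 := by
    by_cases h : ∃ y ∈ ZP S, n (emb y) = n c1
    · obtain ⟨y, hy, hny⟩ := h
      refine ⟨emb y, fun y' hy' hny' => ?_⟩
      by_contra hne'
      exact hcon y hy y' hy' (fun h => hne' (by rw [h])) hny hny'
    · exact ⟨0, fun y hy hny => absurd ⟨y, hy, hny⟩ h⟩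
  have hC : Convex ℝ {p : ℝ × ℝ | n p ≤ n c1 ∧ (n p = n c1 → p = y0)} := by
    rintro p ⟨hp1, hp2⟩ q ⟨hq1, hq2⟩ s t hs ht hst
    rcases hs.eq_or_lt with h | h
    · subst h
      have : t = 1 := by linarith
      subst this
      simpa using ⟨hq1, hq2⟩
    rcases ht.eq_or_lt with h' | h'
    · subst h'
      have : s = 1 := by linarith
      subst this
      simpa using ⟨hp1, hp2⟩
    have hs' : s = 1 - t := by linarith
    have e : n (s • p + t • q) = s * n p + t * n q := by simp
    refine ⟨?_, ?_⟩
    · rw [e, hs']; nlinarith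
    · intro he
      rw [e] at he
      have e1 : n p = n c1 := by
        apply le_antisymm hp1
        subst hs'
        nlinarith
      have e2 : n q = n c1 := by
        apply le_antisymm hq1
        subst hs'
        nlinarith
      rw [hp2 e1, hq2 e2, ← add_smul, hst, one_smul]
  have hsub : S ⊆ {p : ℝ × ℝ | n p ≤ n c1 ∧ (n p = n c1 → p = y0)} := by
    refine hL.trans (convexHull_min ?_ hC)
    rintro _ ⟨y, hy, rfl⟩
    exact ⟨m1 _ hy, hy0 y hy⟩
  have g1 := (hsub h1).2 rfl
  have g2 := (hsub h2).2 (le_antisymm (m1 _ h2) (m2 _ h1))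
  exact hne (g1.trans g2.symm)

lemma ref_slices {Q R : Set (ℝ × ℝ)} (cQ : IsCompact Q)
    (cR : IsCompact R) (nQ : Q.Nonempty) (nR : R.Nonempty) (s s' : ℝ) (hs : 0 ≤ s) (hs1 : s ≤ 1)
    (hs' : 0 < s') (hs1' : s' < 1) (hL : LH (Sl Q R s)) (hL' : LH (Sl Q R s')) :
    Ref2 (Sl Q R s) (Sl Q R s') := by
  intro x hx x' hx' hne htop
  set n : ℝ × ℝ →ₗ[ℝ] ℝ := ((x'.1:ℝ) - x.1) • LinearMap.snd ℝ ℝ ℝ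
    - ((x'.2:ℝ) - x.2) • LinearMap.fst ℝ ℝ ℝ with hn
  have hnv : ∀ p : ℝ × ℝ, n p = ((x'.1:ℝ) - x.1) * p.2 - ((x'.2:ℝ) - x.2) * p.1 := by
    intro p; simp [hn]
  have htopR : ∀ y ∈ Sl Q R s, n y ≤ n (emb x) := by
    have hc : Convex ℝ {y | n y ≤ n (emb x)} := convex_halfSpace_le n.isLinear _
    refine hL.trans (convexHull_min ?_ hc)
    rintro _ ⟨p, hp, rfl⟩
    have := htop p hp
    have : ((x'.1:ℝ) - x.1) * (p.2 - x.2) ≤ (x'.2 - x.2) * (p.1 - x.1) := by exact_mod_cast this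
    show n (emb p) ≤ n (emb x)
    simp only [hnv, emb]
    linarith
  have hxx' : n (emb x') = n (emb x) := by
    simp only [hnv, emb]; ring
  have hneR : emb x ≠ emb x' := by
    intro h
    apply hne
    simp only [emb, Prod.mk.injEq, Int.cast_inj] at h
    exact Prod.ext h.1 h.2
  have htopR' : ∀ y ∈ Sl Q R s, n y ≤ n (emb x') := by rw [hxx']; exact htopR
  obtain ⟨a, ha, b, hb, hab⟩ : emb x ∈ Sl Q R s := hx
  obtain ⟨a', ha', b', hb', hab'⟩ : emb x' ∈ Sl Q R s := hx'
  obtain ⟨a1, ha1, a2, ha2, b1, hb1, b2, hb2, M1, M2, M3, M4, hor⟩ :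
      ∃ a1 ∈ Q, ∃ a2 ∈ Q, ∃ b1 ∈ R, ∃ b2 ∈ R, (∀ c ∈ Q, n c ≤ n a1) ∧ (∀ c ∈ Q, n c ≤ n a2) ∧
        (∀ c ∈ R, n c ≤ n b1) ∧ (∀ c ∈ R, n c ≤ n b2) ∧ (a1 ≠ a2 ∨ b1 ≠ b2) := by
    have hcont : Continuous n := LinearMap.continuous_of_finiteDimensional n
    rw [hab] at htopR
    rw [hab'] at htopR'
    rcases hs1.eq_or_lt with h | h
    · subst h
      obtain ⟨z, hz, hmax⟩ := cQ.exists_isMaxOn nQ hcont.continuousOn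
      refine ⟨z, hz, z, hz, b, hb, b', hb', hmax, hmax, Sl_max_right one_pos n ha htopR,
        Sl_max_right one_pos n ha' htopR', Or.inr ?_⟩
      rintro rfl
      apply hneR
      rw [hab, hab']; simp
    rcases hs.eq_or_lt with h0 | h0
    · subst h0
      obtain ⟨z, hz, hmax⟩ := cR.exists_isMaxOn nR hcont.continuousOn
      refine ⟨a, ha, a', ha', z, hz, z, hz, Sl_max_left h n hb htopR,
        Sl_max_left h n hb' htopR', hmax, hmax, Or.inl ?_⟩
      rintro rfl
      apply hneR
      rw [hab, hab']; simp
    refine ⟨a, ha, a', ha', b, hb, b', hb', Sl_max_left h n hb htopR,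
        Sl_max_left h n hb' htopR', Sl_max_right h0 n ha htopR, Sl_max_right h0 n ha' htopR', ?_⟩
    by_contra hcon
    push Not at hcon
    apply hneR
    rw [hab, hab', hcon.1, hcon.2]
  obtain ⟨c1, hc1, c2, hc2, hcne, N1, N2⟩ : ∃ c1 ∈ Sl Q R s', ∃ c2 ∈ Sl Q R s', c1 ≠ c2 ∧
      (∀ y ∈ Sl Q R s', n y ≤ n c1) ∧ (∀ y ∈ Sl Q R s', n y ≤ n c2) := by
    rcases hor with h | h
    · refine ⟨_, ⟨a1, ha1, b1, hb1, rfl⟩, _, ⟨a2, ha2, b1, hb1, rfl⟩, ?_,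
        Sl_max hs'.le hs1'.le n M1 M3, Sl_max hs'.le hs1'.le n M2 M3⟩
      intro he
      exact h (smul_right_injective _ (sub_pos.2 hs1').ne' (add_right_cancel he))
    · refine ⟨_, ⟨a1, ha1, b1, hb1, rfl⟩, _, ⟨a1, ha1, b2, hb2, rfl⟩, ?_,
        Sl_max hs'.le hs1'.le n M1 M3, Sl_max hs'.le hs1'.le n M1 M4⟩
      intro he
      exact h (smul_right_injective _ hs'.ne' (add_left_cancel he))
  obtain ⟨y, hy, y', hy', hyne, e1, e2⟩ := two_max hL' n c1 c2 hc1 hc2 hcne N1 N2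
  refine ⟨y, hy, y', hy', hyne, ?_, ?_⟩
  · have : n (emb y) = n (emb y') := by rw [e1, e2]
    simp only [hnv, emb] at this
    have : ((x'.1:ℝ) - x.1) * (y'.2 - y.2) = (x'.2 - x.2) * (y'.1 - y.1) := by linarith
    exact_mod_cast this
  · intro q hq
    have := N1 _ hq
    rw [← e1] at this
    simp only [hnv, emb] at this
    have : ((x'.1:ℝ) - x.1) * (q.2 - y.2) ≤ (x'.2 - x.2) * (q.1 - y.1) := by linarith
    exact_mod_cast this

lemma Key_slices {Q R : Set (ℝ × ℝ)} (hQ : Convex ℝ Q) (hR : Convex ℝ R) (cQ : IsCompact Q)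
    (cR : IsCompact R) (nQ : Q.Nonempty) (nR : R.Nonempty) (k : ℕ) (hk : 2 ≤ k)
    (hL : ∀ i : ℕ, i ≤ k → LH (Sl Q R (i / k))) (j : ℕ) (hj : j < k) :
    Key (Sl Q R (j / k)) (Sl Q R ((j + 1 : ℕ) / k)) := by
  have hk0 : (0:ℝ) < k := by positivity
  have le1 : ∀ i : ℕ, i ≤ k → (i:ℝ) / k ≤ 1 := by
    intro i hi
    rw [div_le_one hk0]; exact_mod_cast hi
  have lt1 : ∀ i : ℕ, i < k → (i:ℝ) / k < 1 := by
    intro i hi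
    rw [div_lt_one hk0]; exact_mod_cast hi
  by_cases h : j + 1 < k
  · apply Key_of_Ref2 (Sl_convex hQ hR _) (Sl_convex hQ hR _) (ZP_finite (Sl_compact cQ cR _))
      (ZP_finite (Sl_compact cQ cR _))
    exact ref_slices cQ cR nQ nR _ _ (by positivity) (le1 j hj.le) (by positivity) (lt1 _ h)
      (hL j hj.le) (hL _ hj)
  · apply Key_of_Ref2' (Sl_convex hQ hR _) (Sl_convex hQ hR _) (ZP_finite (Sl_compact cQ cR _))
      (ZP_finite (Sl_compact cQ cR _))
    have hj0 : (0:ℝ) < j := by exact_mod_cast (by omega : 0 < j)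
    exact ref_slices cQ cR nQ nR _ _ (by positivity) (le1 _ hj) (by positivity) (lt1 _ hj)
      (hL _ hj) (hL j hj.le)

def crR (a b c : ℝ × ℝ) : ℝ := (b.1 - a.1) * (c.2 - a.2) - (b.2 - a.2) * (c.1 - a.1)

lemma crR_cyc (a b c : ℝ × ℝ) : crR a b c = crR b c a := by
  simp only [crR]; ring

lemma crR_hull {F S : Set (ℝ × ℝ)} (hS : S ⊆ convexHull ℝ F) (a b : ℝ × ℝ)
    (h : ∀ c ∈ F, crR a b c = 0) : ∀ c ∈ S, crR a b c = 0 := by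
  have hc : Convex ℝ {c | crR a b c = 0} := by
    intro p hp q hq s t hs ht hst
    have hp' : crR a b p = 0 := hp
    have hq' : crR a b q = 0 := hq
    show crR a b _ = 0
    have : s = 1 - t := by linarith
    subst this
    simp only [crR] at hp' hq' ⊢
    simp
    linear_combination (1 - t) * hp' + t * hq'
  exact hS.trans (convexHull_min h hc)

lemma nondeg {Q R : Set (ℝ × ℝ)} (nR : R.Nonempty) {s : ℝ} (hs : s < 1) (hL : LH (Sl Q R s))
    {a b c : ℝ × ℝ} (ha : a ∈ Q) (hb : b ∈ Q) (hc : c ∈ Q) (h : crR a b c ≠ 0) :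
    ∃ p ∈ ZP (Sl Q R s), ∃ q ∈ ZP (Sl Q R s), ∃ r ∈ ZP (Sl Q R s), cr p q r ≠ 0 := by
  by_contra hcon
  push Not at hcon
  obtain ⟨e, he⟩ := nR
  have h0 : ∀ p ∈ emb '' ZP (Sl Q R s), ∀ q ∈ emb '' ZP (Sl Q R s), ∀ r ∈ emb '' ZP (Sl Q R s),
      crR p q r = 0 := by
    rintro _ ⟨p, hp, rfl⟩ _ ⟨q, hq, rfl⟩ _ ⟨r, hr, rfl⟩
    have := hcon p hp q hq r hr
    simp only [cr] at this
    simp only [crR, emb]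
    exact_mod_cast this
  have h1 : ∀ r ∈ Sl Q R s, ∀ p ∈ emb '' ZP (Sl Q R s), ∀ q ∈ emb '' ZP (Sl Q R s),
      crR p q r = 0 := fun r hr p hp q hq => crR_hull hL p q (h0 p hp q hq) r hr
  have h2 : ∀ q ∈ Sl Q R s, ∀ r ∈ Sl Q R s, ∀ p ∈ emb '' ZP (Sl Q R s),
      crR r p q = 0 := fun q hq r hr p hp => crR_hull hL r p (fun q hq => by
        rw [crR_cyc]; exact h1 r hr p hp q hq) q hq
  have h3 : ∀ p ∈ Sl Q R s, ∀ q ∈ Sl Q R s, ∀ r ∈ Sl Q R s,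
      crR q r p = 0 := fun p hp q hq r hr => crR_hull hL q r (fun p hp => by
        rw [crR_cyc]; exact h2 q hq r hr p hp) p hp
  have := h3 _ ⟨a, ha, e, he, rfl⟩ _ ⟨b, hb, e, he, rfl⟩ _ ⟨c, hc, e, he, rfl⟩
  apply h
  have h4 : (1 - s) ^ 2 * crR a b c = 0 := by
    simp only [crR] at this ⊢
    simp at this
    linear_combination this
  have : (1 - s) ^ 2 ≠ 0 := pow_ne_zero _ (sub_pos.2 hs).ne'
  exact (mul_eq_zero.1 h4).resolve_left this

lemma noncol (Q : Set (Fin 2 → ℝ)) (hQ : Q.Nonempty) (h : affineSpan ℝ Q = ⊤) :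
    ∃ a ∈ Q, ∃ b ∈ Q, ∃ c ∈ Q, crR (a 0, a 1) (b 0, b 1) (c 0, c 1) ≠ 0 := by
  by_contra hcon
  push Not at hcon
  obtain ⟨a, ha⟩ := hQ
  obtain ⟨b, hba, hb⟩ : ∃ b : Fin 2 → ℝ, b ≠ a ∧ ∀ c ∈ Q,
      crR (a 0, a 1) (b 0, b 1) (c 0, c 1) = 0 := by
    by_cases hex : ∃ b ∈ Q, b ≠ a
    · obtain ⟨b, hb, hne⟩ := hex
      exact ⟨b, hne, hcon a ha b hb⟩
    · push Not at hex
      refine ⟨a + 1, ?_, ?_⟩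
      · intro h; have := congrFun h 0; simp at this
      · intro c hc; rw [hex c hc]; simp [crR]
  have hd : vectorSpan ℝ Q = ⊤ := by
    rw [← direction_affineSpan, h, AffineSubspace.direction_top]
  rw [vectorSpan_eq_span_vsub_set_right ℝ ha] at hd
  set f : (Fin 2 → ℝ) →ₗ[ℝ] ℝ := (b 0 - a 0) • LinearMap.proj 1 - (b 1 - a 1) • LinearMap.proj 0
    with hf
  have hle : Submodule.span ℝ ((fun x => x -ᵥ a) '' Q) ≤ LinearMap.ker f := by
    rw [Submodule.span_le]
    rintro _ ⟨c, hc, rfl⟩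
    have := hb c hc
    simp only [crR] at this
    simp [hf]
    linarith
  rw [hd] at hle
  apply hba
  have f1 : f ![1, 0] = 0 := hle (Submodule.mem_top)
  have f2 : f ![0, 1] = 0 := hle (Submodule.mem_top)
  simp [hf] at f1 f2
  ext i
  fin_cases i
  · simp; linarith
  · simp; linarith


def pr2 : (Fin 2 → ℝ) →ₗ[ℝ] ℝ × ℝ := (LinearMap.proj 0).prod (LinearMap.proj 1)

lemma pr2_apply (x : Fin 2 → ℝ) : pr2 x = (x 0, x 1) := rfl

def pr3 : (Fin 3 → ℝ) →ₗ[ℝ] ℝ × ℝ := (LinearMap.proj 0).prod (LinearMap.proj 1)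

lemma pr3_apply (x : Fin 3 → ℝ) : pr3 x = (x 0, x 1) := rfl

lemma poly_facts (Q : Set (Fin 2 → ℝ)) (hQ : IsLatticePolytope2 Q) :
    Q.Nonempty ∧ Convex ℝ Q ∧ Convex ℝ (pr2 '' Q) ∧ IsCompact (pr2 '' Q) ∧ LH (pr2 '' Q) := by
  obtain ⟨V, hV, rfl⟩ := hQ
  have himg : pr2 '' (convexHull ℝ (toR2 '' (V : Set (Fin 2 → ℤ)))) =
      convexHull ℝ (pr2 '' (toR2 '' (V : Set (Fin 2 → ℤ)))) :=
    LinearMap.image_convexHull pr2 _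
  refine ⟨?_, convex_convexHull ℝ _, ?_, ?_, ?_⟩
  · obtain ⟨v, hv⟩ := hV
    exact ⟨_, subset_convexHull ℝ _ ⟨v, hv, rfl⟩⟩
  · rw [himg]; exact convex_convexHull ℝ _
  · rw [himg]
    exact ((V.finite_toSet.image _).image _).isCompact_convexHull ℝ
  · unfold LH
    conv_lhs => rw [himg]
    apply convexHull_mono
    rintro _ ⟨_, ⟨v, hv, rfl⟩, rfl⟩
    exact ⟨(v 0, v 1), ⟨toR2 v, subset_convexHull ℝ _ ⟨v, hv, rfl⟩, rfl⟩, rfl⟩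

lemma P_mem (Q₁ Q₂ : Set (Fin 2 → ℝ)) (h1 : Convex ℝ Q₁) (h2 : Convex ℝ Q₂)
    (n1 : Q₁.Nonempty) (n2 : Q₂.Nonempty) (k : ℕ) (hk : 2 ≤ k) (x : Fin 3 → ℝ) :
    x ∈ convexHull ℝ
      ((fun x => (Fin.snoc x (0:ℝ) : Fin 3 → ℝ)) '' Q₁ ∪
        (fun x => (Fin.snoc x (k:ℝ) : Fin 3 → ℝ)) '' Q₂) ↔
    0 ≤ x 2 ∧ x 2 ≤ k ∧ pr3 x ∈ Sl (pr2 '' Q₁) (pr2 '' Q₂) (x 2 / k) := by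
  have hk0 : (0:ℝ) < k := by positivity
  have s0 : ∀ (y : Fin 2 → ℝ) (c : ℝ), (Fin.snoc y c : Fin 3 → ℝ) = ![y 0, y 1, c] := by
    intro y c
    ext i
    fin_cases i <;> simp [Fin.snoc]
  have hcv : ∀ (c : ℝ) (Q : Set (Fin 2 → ℝ)), Convex ℝ Q →
      Convex ℝ ((fun x => (Fin.snoc x c : Fin 3 → ℝ)) '' Q) := by
    rintro c Q hQ _ ⟨y, hy, rfl⟩ _ ⟨z, hz, rfl⟩ s t hs ht hst
    refine ⟨s • y + t • z, hQ hy hz hs ht hst, ?_⟩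
    simp only [s0]
    ext i
    fin_cases i <;> simp
    rw [← add_mul, hst, one_mul]
  rw [(hcv 0 Q₁ h1).convexHull_union (hcv k Q₂ h2) (n1.image _) (n2.image _)]
  simp only [mem_convexJoin]
  constructor
  · rintro ⟨_, ⟨a, ha, rfl⟩, _, ⟨b, hb, rfl⟩, s, t, hs, ht, hst, rfl⟩
    have e : (s • (Fin.snoc a (0:ℝ) : Fin 3 → ℝ) + t • (Fin.snoc b (k:ℝ) : Fin 3 → ℝ)) 2
      = t * k := by simp [s0]
    rw [e]
    refine ⟨by positivity, by nlinarith, pr2 a, ⟨a, ha, rfl⟩, pr2 b, ⟨b, hb, rfl⟩, ?_⟩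
    rw [mul_div_cancel_right₀ _ hk0.ne']
    have : s = 1 - t := by linarith
    subst this
    ext <;> simp [pr3_apply, pr2_apply, s0]
  · rintro ⟨p0, p1, _, ⟨a, ha, rfl⟩, _, ⟨b, hb, rfl⟩, hx⟩
    refine ⟨_, ⟨a, ha, rfl⟩, _, ⟨b, hb, rfl⟩, 1 - x 2 / k, x 2 / k, ?_, by positivity, by ring, ?_⟩
    · rw [sub_nonneg, div_le_one hk0]; exact p1
    · have e1 := congrArg Prod.fst hx
      have e2 := congrArg Prod.snd hx
      simp [pr3_apply, pr2_apply] at e1 e2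
      simp only [s0]
      ext i
      fin_cases i
      · simp [e1]
      · simp [e2]
      · simp; field_simp

lemma WL_finite (j : ℤ) {A B : Set (ℝ × ℝ)} (hA : (ZP A).Finite) (hB : (ZP B).Finite) :
    (WL j A B).Finite := by
  apply Set.Finite.subset ((hA.image (fun p => (![p.1, p.2, j] : Fin 3 → ℤ))).union
    (hB.image (fun p => (![p.1, p.2, j + 1] : Fin 3 → ℤ))))
  rintro p (⟨h, hp⟩ | ⟨h, hp⟩)
  · left
    refine ⟨_, hp, ?_⟩
    ext i; fin_cases i <;> simp [h]
  · right
    refine ⟨_, hp, ?_⟩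
    ext i; fin_cases i <;> simp [h]

lemma lift_hull {S : Set (ℝ × ℝ)} (hL : LH S) (c : ℤ) (W : Set (Fin 3 → ℤ))
    (hW : ∀ p ∈ ZP S, (![p.1, p.2, c] : Fin 3 → ℤ) ∈ W) (y : ℝ × ℝ) (hy : y ∈ S) :
    (![y.1, y.2, (c:ℝ)] : Fin 3 → ℝ) ∈ convexHull ℝ (toR3 '' W) := by
  have hc : Convex ℝ {y : ℝ × ℝ | (![y.1, y.2, (c:ℝ)] : Fin 3 → ℝ) ∈ convexHull ℝ (toR3 '' W)} := by
    intro p hp q hq s t hs ht hst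
    have := convex_convexHull ℝ (toR3 '' W) hp hq hs ht hst
    show (![(s • p + t • q).1, (s • p + t • q).2, (c:ℝ)] : Fin 3 → ℝ) ∈ convexHull ℝ (toR3 '' W)
    convert this using 1
    ext i; fin_cases i <;> simp
    rw [← add_mul, hst, one_mul]
  have : S ⊆ _ := hL.trans (convexHull_min ?_ hc)
  · exact this hy
  · rintro _ ⟨p, hp, rfl⟩
    apply subset_convexHull
    refine ⟨_, hW p hp, ?_⟩
    ext i; fin_cases i <;> simp [toR3, emb]

lemma tet_unimod (v : Fin 4 → Fin 3 → ℤ) (h : |Dv v| = 1) : IsUnimodularTet (Tet v) := by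
  refine ⟨v, ?_, ?_⟩
  · unfold Tet
    congr 1
    ext x
    simp only [Set.mem_range, Set.mem_insert_iff, Set.mem_singleton_iff]
    constructor
    · rintro ⟨i, rfl⟩
      fin_cases i <;> simp
    · rintro (rfl | rfl | rfl | rfl)
      exacts [⟨0, rfl⟩, ⟨1, rfl⟩, ⟨2, rfl⟩, ⟨3, rfl⟩]
  · show Dv v ∈ _
    rcases eq_or_eq_neg_of_abs_eq h with h | h <;> simp [h]

/-- Let `Q₁, Q₂` be lattice polygons, `k ≥ 2`, and
`P = conv(Q₁×{0} ∪ Q₂×{k})`.  If the slice `P ∩ (ℝ²×{1})` is a lattice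
polygon (the convex hull of its lattice points), then `P` has a unimodular
cover. -/
theorem prismatoid_lattice_slice_cover
    (Q₁ Q₂ : Set (Fin 2 → ℝ))
    (hQ₁ : IsLatticePolytope2 Q₁) (hQ₁dim : affineSpan ℝ Q₁ = ⊤)
    (hQ₂ : IsLatticePolytope2 Q₂) (hQ₂dim : affineSpan ℝ Q₂ = ⊤)
    (k : ℕ) (hk : 2 ≤ k)
    (P : Set (Fin 3 → ℝ))
    (hPdef : P = convexHull ℝ
      ((fun x => Fin.snoc x (0:ℝ)) '' Q₁ ∪ (fun x => Fin.snoc x (k:ℝ)) '' Q₂))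
    (hslice : P ∩ {y | y 2 = 1} =
      convexHull ℝ ((P ∩ {y | y 2 = 1}) ∩ Lat3)) :
    HasUnimodularCover P := by
  obtain ⟨n1, c1, hQ, cQ, LQ⟩ := poly_facts Q₁ hQ₁
  obtain ⟨n2, c2, hR, cR, LR⟩ := poly_facts Q₂ hQ₂
  have hP : ∀ x, x ∈ P ↔ 0 ≤ x 2 ∧ x 2 ≤ k ∧ pr3 x ∈ Sl (pr2 '' Q₁) (pr2 '' Q₂) (x 2 / k) := by
    intro x
    rw [hPdef]
    exact P_mem Q₁ Q₂ c1 c2 n1 n2 k hk x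
  have hPc : Convex ℝ P := by rw [hPdef]; exact convex_convexHull ℝ _
  obtain ⟨ta, hta, tb, htb, tc, htc, hnc⟩ := noncol Q₁ n1 hQ₁dim
  have nQ := n1.image pr2
  have nR := n2.image pr2
  have hta' : pr2 ta ∈ pr2 '' Q₁ := ⟨ta, hta, rfl⟩
  have htb' : pr2 tb ∈ pr2 '' Q₁ := ⟨tb, htb, rfl⟩
  have htc' : pr2 tc ∈ pr2 '' Q₁ := ⟨tc, htc, rfl⟩
  have hnc' : crR (pr2 ta) (pr2 tb) (pr2 tc) ≠ 0 := hnc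
  generalize pr2 '' Q₁ = Q at *
  generalize pr2 '' Q₂ = R at *
  have hk0 : (0:ℝ) < k := by positivity
  have hk1 : (1:ℝ) ≤ k := by exact_mod_cast (by omega : 1 ≤ k)
  have L1 : LH (Sl Q R (1 / k)) := by
    intro y hy
    have hyP : (![y.1, y.2, 1] : Fin 3 → ℝ) ∈ P ∩ {y | y 2 = 1} := by
      refine ⟨(hP _).2 ⟨by simp, by simpa using hk1, ?_⟩, by simp⟩
      simpa [pr3_apply] using hy
    rw [hslice] at hyP
    have hc : Convex ℝ (pr3 ⁻¹' (convexHull ℝ (emb '' ZP (Sl Q R (1 / k))))) :=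
      (convex_convexHull ℝ _).linear_preimage pr3
    have := convexHull_min (t := pr3 ⁻¹' (convexHull ℝ (emb '' ZP (Sl Q R (1 / k))))) ?_ hc hyP
    · simpa [pr3_apply] using this
    · rintro _ ⟨⟨hz, hz1⟩, v, rfl⟩
      apply subset_convexHull
      have hz1 : toR3 v 2 = 1 := hz1
      have := ((hP _).1 hz).2.2
      rw [hz1] at this
      exact ⟨(v 0, v 1), this, rfl⟩
  have hL := LH_slices hQ hR cQ cR nQ nR LQ k hk L1
  have hne : ∀ s, (Sl Q R s).Nonempty := by
    intro s
    obtain ⟨a, ha⟩ := nQ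
    obtain ⟨b, hb⟩ := nR
    exact ⟨_, a, ha, b, hb, rfl⟩
  refine ⟨{S | IsUnimodularTet S ∧ S ⊆ P}, fun S hS => hS, ?_⟩
  apply Set.Subset.antisymm
  · exact Set.sUnion_subset (fun S hS => hS.2)
  intro x hx
  obtain ⟨x0, xk, hxS⟩ := (hP x).1 hx
  obtain ⟨j, hj, hj0, hj1⟩ : ∃ j : ℕ, j < k ∧ (j:ℝ) ≤ x 2 ∧ x 2 ≤ j + 1 := by
    rcases xk.eq_or_lt with h | h
    · refine ⟨k - 1, by omega, ?_, ?_⟩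
      · rw [h, Nat.cast_sub (by omega)]; simp
      · rw [h, Nat.cast_sub (by omega)]; simp
    · refine ⟨⌊x 2⌋₊, ?_, Nat.floor_le x0, (Nat.lt_floor_add_one _).le⟩
      rw [Nat.floor_lt x0]; exact h
  set A := Sl Q R (j / k) with hA
  set B := Sl Q R ((j + 1 : ℕ) / k) with hB
  have hK : Key A B := Key_slices hQ hR cQ cR nQ nR k hk hL j hj
  have LA : LH A := hL j hj.le
  have LB : LH B := hL (j + 1) hj
  have hWP : ∀ w ∈ WL (j:ℤ) A B, toR3 w ∈ P := by
    rintro w (⟨h, hw⟩ | ⟨h, hw⟩)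
    · rw [hP]
      have e : toR3 w 2 = (j:ℝ) := by simp [toR3, h]
      rw [e]
      exact ⟨by positivity, by exact_mod_cast hj.le, hw⟩
    · rw [hP]
      have e : toR3 w 2 = ((j + 1 : ℕ):ℝ) := by simp [toR3, h]
      rw [e]
      exact ⟨by positivity, by exact_mod_cast hj, hw⟩
  have lA : ∀ p ∈ ZP A, (![p.1, p.2, (j:ℤ)] : Fin 3 → ℤ) ∈ WL (j:ℤ) A B := by
    intro p hp; left; exact ⟨by simp, by simpa using hp⟩
  have lB : ∀ p ∈ ZP B, (![p.1, p.2, (j:ℤ) + 1] : Fin 3 → ℤ) ∈ WL (j:ℤ) A B := by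
    intro p hp; right; exact ⟨by simp, by simpa using hp⟩
  obtain ⟨v0, hv0, hD0⟩ : ∃ v0 : Fin 4 → Fin 3 → ℤ, (∀ i, v0 i ∈ WL (j:ℤ) A B) ∧ Dv v0 ≠ 0 := by
    have hj1 : (j:ℝ) / k < 1 := by
      rw [div_lt_one hk0]; exact_mod_cast hj
    obtain ⟨p, hp, q, hq, r, hr, hcr⟩ := nondeg nR hj1 LA hta' htb' htc' hnc'
    obtain ⟨z, hz⟩ : (ZP B).Nonempty := by
      obtain ⟨y, hy⟩ := hne ((j + 1 : ℕ) / k)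
      have : (convexHull ℝ (emb '' ZP B)).Nonempty := ⟨y, LB hy⟩
      rw [convexHull_nonempty_iff] at this
      exact Set.image_nonempty.1 this
    refine ⟨![![p.1, p.2, j], ![q.1, q.2, j], ![r.1, r.2, j], ![z.1, z.2, j + 1]], ?_, ?_⟩
    · intro i
      fin_cases i
      · exact lA p hp
      · exact lA q hq
      · exact lA r hr
      · exact lB z hz
    · rw [Dv_eq]
      simp only [cr] at hcr
      simp
      intro h
      apply hcr
      linarith
  have hxc : x ∈ convexHull ℝ (toR3 '' WL (j:ℤ) A B) := by
    obtain ⟨a, ha, b, hb, hab⟩ := hxS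
    have u1 := lift_hull LA j _ lA ((1 - (j:ℝ) / k) • a + ((j:ℝ) / k) • b) ⟨a, ha, b, hb, rfl⟩
    have u2 := lift_hull LB (j + 1) _ lB
      ((1 - ((j + 1 : ℕ):ℝ) / k) • a + (((j + 1 : ℕ):ℝ) / k) • b) ⟨a, ha, b, hb, rfl⟩
    have := convex_convexHull ℝ _ u1 u2 (a := j + 1 - x 2) (b := x 2 - j) (by linarith)
      (by linarith) (by ring)
    convert this using 1
    have e1 := congrArg Prod.fst hab
    have e2 := congrArg Prod.snd hab
    simp [pr3_apply] at e1 e2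
    ext i
    fin_cases i
    · simp [e1]; field_simp; ring
    · simp [e2]; field_simp; ring
    · simp; ring
  obtain ⟨v, hv, hD, hxv⟩ := layer_cover j A B (Sl_convex hQ hR _) (Sl_convex hQ hR _) hK
    (WL_finite _ (ZP_finite (Sl_compact cQ cR _)) (ZP_finite (Sl_compact cQ cR _))) v0 hv0 hD0 x hxc
  refine ⟨Tet v, ⟨tet_unimod v hD, ?_⟩, hxv⟩
  apply convexHull_min _ hPc
  rintro _ ⟨i, rfl⟩
  exact hWP _ (hv i)
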